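/- Let n ≥ 1 and 1 < p < 2. Let u ∈ C²(ℝⁿ₊) ∩ C(cl ℝⁿ₊) be a classical solution of -Δu = |∇u|^p in ℝⁿ₊ with u = 0 on ∂ℝⁿ₊. Then there exists a constant M₁ > 0 such that |u(x', xₙ)| ≤ M₁ xₙ for all x' ∈ ℝⁿ⁻¹ and all 0 < xₙ ≤ 1. -/

import Mathlib

/-- The classical Laplacian of `u : ℝⁿ → ℝ`: the sum of the pure second
derivatives `∂²u/∂xᵢ²`. -/
noncomputable def laplacian {n : ℕ} (u : EuclideanSpace ℝ (Fin n) → ℝ)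
    (x : EuclideanSpace ℝ (Fin n)) : ℝ :=
  ∑ i, iteratedFDeriv ℝ 2 u x ![EuclideanSpace.single i 1, EuclideanSpace.single i 1]

/-- The open half-space `ℝⁿ₊ = {x ∈ ℝⁿ : xₙ > 0}` (dimension `n + 1`, so `n + 1 ≥ 1`). -/
def halfSpace (n : ℕ) : Set (EuclideanSpace ℝ (Fin (n + 1))) :=
  {x | 0 < x (Fin.last n)}

open Filter Topology Set

/-- second-order one-dimensional jet at `0` -/
def JetAt (φ : ℝ → ℝ) (a b : ℝ) : Prop :=
  ∃ φ' : ℝ → ℝ, (∀ᶠ s in 𝓝 (0:ℝ), HasDerivAt φ (φ' s) s) ∧ φ' 0 = a ∧ HasDerivAt φ' b 0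

lemma JetAt.congr_vals {φ : ℝ → ℝ} {a b a' b' : ℝ} (h : JetAt φ a b) (ha : a = a') (hb : b = b') :
    JetAt φ a' b' := by subst ha; subst hb; exact h

lemma JetAt.hasDerivAt {φ : ℝ → ℝ} {a b : ℝ} (h : JetAt φ a b) : HasDerivAt φ a 0 := by
  obtain ⟨φ', h1, h2, h3⟩ := h
  rw [← h2]; exact h1.self_of_nhds

lemma JetAt.const (c : ℝ) : JetAt (fun _ => c) 0 0 :=
  ⟨fun _ => 0, Eventually.of_forall fun s => hasDerivAt_const s c, rfl, hasDerivAt_const 0 0⟩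

lemma JetAt.add {φ ψ : ℝ → ℝ} {a b a' b' : ℝ} (h : JetAt φ a b) (h' : JetAt ψ a' b') :
    JetAt (fun s => φ s + ψ s) (a + a') (b + b') := by
  obtain ⟨φ', h1, h2, h3⟩ := h
  obtain ⟨ψ', k1, k2, k3⟩ := h'
  refine ⟨fun s => φ' s + ψ' s, ?_, by simp [h2, k2], h3.add k3⟩
  filter_upwards [h1, k1] with s hs ks using hs.add ks

lemma JetAt.mul {φ ψ : ℝ → ℝ} {a b a' b' : ℝ} (h : JetAt φ a b) (h' : JetAt ψ a' b') :
    JetAt (fun s => φ s * ψ s) (a * ψ 0 + φ 0 * a') (b * ψ 0 + 2 * a * a' + φ 0 * b') := by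
  have hd := h.hasDerivAt
  have kd := h'.hasDerivAt
  obtain ⟨φ', h1, h2, h3⟩ := h
  obtain ⟨ψ', k1, k2, k3⟩ := h'
  refine ⟨fun s => φ' s * ψ s + φ s * ψ' s, ?_, by simp [h2, k2], ?_⟩
  · filter_upwards [h1, k1] with s hs ks using hs.mul ks
  · refine ((h3.mul kd).add (hd.mul k3)).congr_deriv ?_
    rw [h2, k2]; ring

lemma JetAt.const_mul {φ : ℝ → ℝ} {a b : ℝ} (c : ℝ) (h : JetAt φ a b) :
    JetAt (fun s => c * φ s) (c * a) (c * b) :=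
  ((JetAt.const c).mul h).congr_vals (by ring) (by ring)

lemma JetAt.sub {φ ψ : ℝ → ℝ} {a b a' b' : ℝ} (h : JetAt φ a b) (h' : JetAt ψ a' b') :
    JetAt (fun s => φ s - ψ s) (a - a') (b - b') := by
  have := h.add (h'.const_mul (-1))
  refine (?_ : JetAt _ _ _)
  convert this using 1
  · funext s; ring
  · ring
  · ring

lemma JetAt.sum {ι : Type*} (S : Finset ι) {φ : ι → ℝ → ℝ} {a b : ι → ℝ}
    (h : ∀ i ∈ S, JetAt (φ i) (a i) (b i)) :
    JetAt (fun s => ∑ i ∈ S, φ i s) (∑ i ∈ S, a i) (∑ i ∈ S, b i) := by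
  classical
  induction S using Finset.induction_on with
  | empty => simpa using JetAt.const 0
  | insert i S hi ih =>
    simp only [Finset.sum_insert hi]
    exact (h i (by simp)).add (ih fun j hj => h j (by simp [hj]))

lemma JetAt.comp {φ : ℝ → ℝ} {a b : ℝ} {G G' : ℝ → ℝ} {G'' : ℝ} (h : JetAt φ a b)
    (hG : ∀ᶠ t in 𝓝 (φ 0), HasDerivAt G (G' t) t) (hG' : HasDerivAt G' G'' (φ 0)) :
    JetAt (fun s => G (φ s)) (G' (φ 0) * a) (G'' * a ^ 2 + G' (φ 0) * b) := by
  have hd := h.hasDerivAt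
  obtain ⟨φ', h1, h2, h3⟩ := h
  refine ⟨fun s => G' (φ s) * φ' s, ?_, by simp [h2], ?_⟩
  · have := hd.continuousAt.eventually hG
    filter_upwards [h1, this] with s hs ks using ks.comp s hs
  · refine ((hG'.comp (0:ℝ) hd).mul h3).congr_deriv ?_
    rw [h2]; simp only [Function.comp]; ring

lemma JetAt.pow {φ : ℝ → ℝ} {a b : ℝ} (h : JetAt φ a b) (k : ℕ) :
    JetAt (fun s => φ s ^ (k + 2)) ((k + 2) * φ 0 ^ (k + 1) * a)
      ((k + 2) * (k + 1) * φ 0 ^ k * a ^ 2 + (k + 2) * φ 0 ^ (k + 1) * b) := by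
  refine (h.comp (G := fun t => t ^ (k+2)) (G' := fun t => (k+2) * t ^ (k+1))
    (G'' := (k + 2) * (k + 1) * φ 0 ^ k) ?_ ?_)
  · refine Eventually.of_forall fun t => ?_
    simpa using hasDerivAt_pow (k+2) t
  · have := (hasDerivAt_pow (k+1) (φ 0)).const_mul ((k:ℝ)+2)
    refine this.congr_deriv ?_
    push_cast; ring

lemma JetAt.max {φ : ℝ → ℝ} {a b : ℝ} (h : JetAt φ a b) (hm : IsLocalMax φ 0) :
    a = 0 ∧ b ≤ 0 := by
  have ha : a = 0 := hm.hasDerivAt_eq_zero h.hasDerivAt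
  refine ⟨ha, ?_⟩
  by_contra hb
  push Not at hb
  have hc := h.hasDerivAt.continuousAt
  obtain ⟨φ', h1, h2, h3⟩ := h
  have e1 : deriv φ =ᶠ[𝓝 0] φ' := h1.mono fun s hs => hs.deriv
  have hmin : IsLocalMin φ 0 := by
    apply isLocalMin_of_deriv_deriv_pos _ _ hc
    · rw [e1.deriv_eq, h3.deriv]; exact hb
    · rw [e1.self_of_nhds, h2, ha]
  have hcst : φ =ᶠ[𝓝 0] fun _ => φ 0 := by
    filter_upwards [hmin, hm] with s h1 h2 using le_antisymm h2 h1
  have e2 : φ' =ᶠ[𝓝 0] fun _ => 0 := by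
    have : deriv φ =ᶠ[𝓝 0] deriv (fun _ => φ 0) := hcst.deriv
    filter_upwards [this, e1] with s hs hs'
    rw [← hs', hs]; simp
  have := e2.deriv_eq
  rw [h3.deriv] at this
  simp at this
  linarith

lemma jet_of_contDiffAt {E : Type*} [NormedAddCommGroup E] [NormedSpace ℝ E] {u : E → ℝ} {x : E}
    (h : ContDiffAt ℝ 2 u x) (v : E) :
    JetAt (fun s => u (x + s • v)) (fderiv ℝ u x v) (fderiv ℝ (fderiv ℝ u) x v v) := by
  have hline : ∀ s : ℝ, HasDerivAt (fun s : ℝ => x + s • v) v s := fun s => by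
    simpa using ((hasDerivAt_id s).smul_const v).const_add x
  have hx0 : x + (0:ℝ) • v = x := by simp
  have hd : ∀ᶠ y in 𝓝 x, HasFDerivAt u (fderiv ℝ u y) y := by
    have := h.eventually (by simp)
    filter_upwards [this] with y hy
    exact (hy.differentiableAt (by norm_num)).hasFDerivAt
  have hd2 : HasFDerivAt (fderiv ℝ u) (fderiv ℝ (fderiv ℝ u) x) x := by
    have : ContDiffAt ℝ 1 (fderiv ℝ u) x := h.fderiv_right (by norm_num)
    exact (this.differentiableAt (by norm_num)).hasFDerivAt
  refine ⟨fun s => fderiv ℝ u (x + s • v) v, ?_, by simp, ?_⟩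
  · have ht : Tendsto (fun s : ℝ => x + s • v) (𝓝 0) (𝓝 x) := by
      have := (hline 0).continuousAt.tendsto
      rwa [hx0] at this
    filter_upwards [ht.eventually hd] with s hs
    exact hs.comp_hasDerivAt s (hline s)
  · rw [← hx0] at hd2
    have := hd2.comp_hasDerivAt (0:ℝ) (hline 0)
    have h3 := this.clm_apply (hasDerivAt_const (0:ℝ) v)
    simpa using h3

lemma laplacian_eq {d : ℕ} (u : EuclideanSpace ℝ (Fin d) → ℝ) (x : EuclideanSpace ℝ (Fin d)) :
    laplacian u x = ∑ i, fderiv ℝ (fderiv ℝ u) x (EuclideanSpace.single i 1)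
      (EuclideanSpace.single i 1) := by
  unfold laplacian
  simp [iteratedFDeriv_two_apply]

lemma gradient_norm_sq {d : ℕ} (u : EuclideanSpace ℝ (Fin d) → ℝ) (x : EuclideanSpace ℝ (Fin d)) :
    ‖gradient u x‖ ^ 2 = ∑ i, (fderiv ℝ u x (EuclideanSpace.single i 1)) ^ 2 := by
  rw [EuclideanSpace.norm_sq_eq]
  refine Finset.sum_congr rfl fun i _ => ?_
  have : fderiv ℝ u x (EuclideanSpace.single i 1) = gradient u x i := by
    unfold gradient
    rw [← InnerProductSpace.toDual_symm_apply, real_inner_comm, EuclideanSpace.inner_single_left]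
    simp
  rw [this]; simp

lemma norm_fderiv_eq {d : ℕ} (u : EuclideanSpace ℝ (Fin d) → ℝ) (x : EuclideanSpace ℝ (Fin d)) :
    ‖fderiv ℝ u x‖ = ‖gradient u x‖ := by
  unfold gradient; simp


lemma diffquot_tendsto {E F : Type*} [NormedAddCommGroup E] [NormedSpace ℝ E]
    [NormedAddCommGroup F] [NormedSpace ℝ F] {φ : E → F} {φ' : E →L[ℝ] F} {x : E}
    (hφ : HasStrictFDerivAt φ φ' x) {y : ℕ → E} (hy : Tendsto y atTop (𝓝 x))
    {h : ℕ → ℝ} (hh : Tendsto h atTop (𝓝 0)) (hne : ∀ k, h k ≠ 0) (v : E) :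
    Tendsto (fun k => (h k)⁻¹ • (φ (y k + h k • v) - φ (y k))) atTop (𝓝 (φ' v)) := by
  have h1 : Tendsto (fun k => (y k + h k • v, y k)) atTop (𝓝 (x, x)) := by
    refine Tendsto.prodMk_nhds ?_ hy
    simpa using hy.add (hh.smul_const v)
  have h2 := hφ.isLittleO.comp_tendsto h1
  have h3 : (fun k => φ (y k + h k • v) - φ (y k) - φ' (h k • v)) =o[atTop] h := by
    have h4 : (fun k => h k • v) =O[atTop] h := by
      refine Asymptotics.IsBigO.of_bound ‖v‖ (Eventually.of_forall fun k => ?_)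
      rw [norm_smul, mul_comm]
    refine Asymptotics.IsLittleO.trans_isBigO ?_ h4
    refine h2.congr (fun k => ?_) (fun k => ?_) <;> simp
  have h5 : (fun k => (h k)⁻¹ • (φ (y k + h k • v) - φ (y k) - φ' (h k • v))) =o[atTop]
      (fun k => (h k)⁻¹ • h k) := (Asymptotics.isBigO_refl (fun k => (h k)⁻¹) atTop).smul_isLittleO h3
  have h6 : (fun k => (h k)⁻¹ • h k) = fun _ => (1:ℝ) := by
    funext k; simp [hne k]
  rw [h6, Asymptotics.isLittleO_one_iff] at h5
  have h7 := h5.add_const (φ' v)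
  rw [zero_add] at h7
  refine h7.congr fun k => ?_
  rw [smul_sub, map_smul, smul_smul, inv_mul_cancel₀ (hne k), one_smul, sub_add_cancel]

lemma grad_pow_strict {d : ℕ} {u : EuclideanSpace ℝ (Fin d) → ℝ} {y : EuclideanSpace ℝ (Fin d)}
    (p : ℝ) (h : ContDiffAt ℝ 2 u y)
    (hw : 0 < ∑ i, (fderiv ℝ u y (EuclideanSpace.single i 1)) ^ 2) :
    ∃ G : EuclideanSpace ℝ (Fin d) →L[ℝ] ℝ,
      HasStrictFDerivAt (fun z => ‖gradient u z‖ ^ p) G y ∧ ∀ v, G v =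
        p / 2 * (∑ i, (fderiv ℝ u y (EuclideanSpace.single i 1)) ^ 2) ^ (p / 2 - 1) *
          ∑ l, 2 * fderiv ℝ u y (EuclideanSpace.single l 1) *
            fderiv ℝ (fderiv ℝ u) y v (EuclideanSpace.single l 1) := by
  have h1 : HasStrictFDerivAt (fderiv ℝ u) (fderiv ℝ (fderiv ℝ u) y) y :=
    (h.fderiv_right (m := 1) (by norm_num)).hasStrictFDerivAt (by norm_num)
  have h2 : ∀ l : Fin d, HasStrictFDerivAt
      (fun z => (fderiv ℝ u z (EuclideanSpace.single l 1)) ^ 2)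
      ((2 * fderiv ℝ u y (EuclideanSpace.single l 1)) •
        ((fderiv ℝ (fderiv ℝ u) y).flip (EuclideanSpace.single l 1))) y := by
    intro l
    have h3 : HasStrictFDerivAt (fun z => fderiv ℝ u z (EuclideanSpace.single l 1))
        ((fderiv ℝ (fderiv ℝ u) y).flip (EuclideanSpace.single l 1)) y := by
      have := h1.clm_apply (hasStrictFDerivAt_const (EuclideanSpace.single l (1:ℝ)) y)
      refine this.congr_fderiv ?_
      ext v; simp
    have := h3.pow 2
    refine this.congr_fderiv ?_
    ext v; simp
  have h3 := HasStrictFDerivAt.fun_sum (u := Finset.univ) (fun l _ => h2 l)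
  have h4 := (Real.hasStrictDerivAt_rpow_const (p := p / 2) (Or.inl hw.ne')).comp_hasStrictFDerivAt y h3
  refine ⟨_, h4.congr_of_eventuallyEq ?_, ?_⟩
  · refine Eventually.of_forall fun z => ?_
    simp only [Function.comp]
    rw [← gradient_norm_sq, ← Real.rpow_natCast, ← Real.rpow_mul (norm_nonneg _)]
    congr 1; push_cast; ring
  · intro v
    simp


lemma jet_cutoff {d : ℕ} (x0 y : EuclideanSpace ℝ (Fin d)) (r : ℝ) (j : Fin d) :
    JetAt (fun s : ℝ => r ^ 2 - ‖y + s • EuclideanSpace.single j (1:ℝ) - x0‖ ^ 2)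
      (-2 * (y - x0) j) (-2) := by
  have h : ∀ s : ℝ, r ^ 2 - ‖y + s • EuclideanSpace.single j (1:ℝ) - x0‖ ^ 2
      = r ^ 2 - ‖y - x0‖ ^ 2 - 2 * (y - x0) j * s - s ^ 2 := by
    intro s
    have : y + s • EuclideanSpace.single j (1:ℝ) - x0
      = (y - x0) + s • EuclideanSpace.single j (1:ℝ) := by abel
    rw [this, norm_add_sq_real, inner_smul_right, EuclideanSpace.inner_single_right, norm_smul]
    simp
    ring
  refine ⟨fun s => -2 * (y - x0) j - 2 * s, Eventually.of_forall fun s => ?_, by simp, ?_⟩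
  · simp only [h]
    have h1 := ((hasDerivAt_id s).const_mul (2 * (y - x0) j)).const_sub (r ^ 2 - ‖y - x0‖ ^ 2)
    have h2 := h1.sub (hasDerivAt_pow 2 s)
    refine h2.congr_deriv ?_
    simp
  · refine (((hasDerivAt_id (0:ℝ)).const_mul 2).const_sub (-2 * (y - x0) j)).congr_deriv ?_
    simp

/-- directional difference quotient -/
noncomputable def dq {d : ℕ} (u : EuclideanSpace ℝ (Fin d) → ℝ) (h : ℝ) (i : Fin d)
    (y : EuclideanSpace ℝ (Fin d)) : ℝ :=
  h⁻¹ * (u (y + h • EuclideanSpace.single i 1) - u y)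

lemma jet_dq {d : ℕ} {u : EuclideanSpace ℝ (Fin d) → ℝ} {h : ℝ} {i : Fin d}
    {y : EuclideanSpace ℝ (Fin d)} (h1 : ContDiffAt ℝ 2 u y)
    (h2 : ContDiffAt ℝ 2 u (y + h • EuclideanSpace.single i 1)) (v : EuclideanSpace ℝ (Fin d)) :
    JetAt (fun s => dq u h i (y + s • v))
      ((h⁻¹ • (fderiv ℝ u (y + h • EuclideanSpace.single i 1) - fderiv ℝ u y)) v)
      (h⁻¹ * (fderiv ℝ (fderiv ℝ u) (y + h • EuclideanSpace.single i 1) v v -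
        fderiv ℝ (fderiv ℝ u) y v v)) := by
  have := ((jet_of_contDiffAt h2 v).sub (jet_of_contDiffAt h1 v)).const_mul h⁻¹
  unfold dq
  refine JetAt.congr_vals (φ := _) (?_ : JetAt _ _ _) rfl rfl
  convert this using 1
  · funext s
    rw [add_right_comm]
  · simp

lemma bernstein_discrete {d : ℕ} {u : EuclideanSpace ℝ (Fin d) → ℝ} {h r p : ℝ} {k : ℕ}
    {x0 y : EuclideanSpace ℝ (Fin d)} {U : Set (EuclideanSpace ℝ (Fin d))}
    (hU : IsOpen U) (hu : ContDiffOn ℝ 2 u U)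
    (heq : ∀ x ∈ U, -laplacian u x = ‖gradient u x‖ ^ p)
    (hy : y ∈ U) (hyi : ∀ i, y + h • EuclideanSpace.single i (1:ℝ) ∈ U)
    (hm : IsLocalMax (fun z => (r ^ 2 - ‖z - x0‖ ^ 2) ^ (k + 2) * ∑ i, dq u h i z ^ 2) y) :
    (∀ j, ((k + 2) * (r ^ 2 - ‖y - x0‖ ^ 2) ^ (k + 1) * (-2 * (y - x0) j)) * (∑ i, dq u h i y ^ 2)
      + (r ^ 2 - ‖y - x0‖ ^ 2) ^ (k + 2) * ∑ i, (2 * dq u h i y *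
        (h⁻¹ • (fderiv ℝ u (y + h • EuclideanSpace.single i 1) - fderiv ℝ u y))
          (EuclideanSpace.single j 1)) = 0) ∧
    (∑ j, (((k + 2) * (k + 1) * (r ^ 2 - ‖y - x0‖ ^ 2) ^ k * (-2 * (y - x0) j) ^ 2 +
        (k + 2) * (r ^ 2 - ‖y - x0‖ ^ 2) ^ (k + 1) * (-2)) * (∑ i, dq u h i y ^ 2)
      + 2 * ((k + 2) * (r ^ 2 - ‖y - x0‖ ^ 2) ^ (k + 1) * (-2 * (y - x0) j)) *
        (∑ i, (2 * dq u h i y *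
        (h⁻¹ • (fderiv ℝ u (y + h • EuclideanSpace.single i 1) - fderiv ℝ u y))
          (EuclideanSpace.single j 1)))
      + (r ^ 2 - ‖y - x0‖ ^ 2) ^ (k + 2) * ∑ i, 2 * ((h⁻¹ •
        (fderiv ℝ u (y + h • EuclideanSpace.single i 1) - fderiv ℝ u y))
          (EuclideanSpace.single j 1)) ^ 2)
      - (r ^ 2 - ‖y - x0‖ ^ 2) ^ (k + 2) * ∑ i, 2 * dq u h i y *
        (h⁻¹ • (‖gradient u (y + h • EuclideanSpace.single i 1)‖ ^ p - ‖gradient u y‖ ^ p))) ≤ 0 := by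
  have hc : ∀ z ∈ U, ContDiffAt ℝ 2 u z := fun z hz => hu.contDiffAt (hU.mem_nhds hz)
  set T : Fin d → Fin d → ℝ := fun i j =>
    h⁻¹ * (fderiv ℝ (fderiv ℝ u) (y + h • EuclideanSpace.single i 1) (EuclideanSpace.single j 1)
      (EuclideanSpace.single j 1) -
        fderiv ℝ (fderiv ℝ u) y (EuclideanSpace.single j 1) (EuclideanSpace.single j 1)) with hT
  set q := r ^ 2 - ‖y - x0‖ ^ 2 with hq
  set Lv : Fin d → Fin d → ℝ := fun i j =>
    (h⁻¹ • (fderiv ℝ u (y + h • EuclideanSpace.single i 1) - fderiv ℝ u y))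
          (EuclideanSpace.single j 1) with hL
  have key : ∀ j, JetAt (fun s : ℝ => (r ^ 2 - ‖y + s • EuclideanSpace.single j (1:ℝ) - x0‖ ^ 2) ^ (k + 2)
      * ∑ i, dq u h i (y + s • EuclideanSpace.single j (1:ℝ)) ^ 2)
      (((k + 2) * q ^ (k + 1) * (-2 * (y - x0) j)) * (∑ i, dq u h i y ^ 2) + q ^ (k+2) *
        ∑ i, 2 * dq u h i y * Lv i j)
      (((k + 2) * (k + 1) * q ^ k * (-2 * (y - x0) j) ^ 2 +
        (k + 2) * q ^ (k + 1) * (-2)) * (∑ i, dq u h i y ^ 2)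
      + 2 * ((k + 2) * q ^ (k + 1) * (-2 * (y - x0) j)) *
        (∑ i, (2 * dq u h i y * Lv i j)) + q ^ (k+2) *
          ∑ i, (2 * Lv i j ^ 2 + 2 * dq u h i y * T i j)) := by
    intro j
    have a1 := (jet_cutoff x0 y r j).pow k
    have a2 : ∀ i ∈ Finset.univ, JetAt (fun s : ℝ => dq u h i (y + s • EuclideanSpace.single j (1:ℝ)) ^ 2)
        (2 * dq u h i y * Lv i j) (2 * Lv i j ^ 2 + 2 * dq u h i y * T i j) := by
      intro i _
      have := (jet_dq (hc y hy) (hc _ (hyi i)) (EuclideanSpace.single j (1:ℝ))).pow 0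
      refine JetAt.congr_vals this ?_ ?_
      · simp [hL]
      · simp [hL, hT]
    have a3 := JetAt.sum Finset.univ a2
    refine JetAt.congr_vals (a1.mul a3) ?_ ?_
    · simp [hq]
    · simp [hq]
  have hmax : ∀ j, IsLocalMax (fun s : ℝ => (r ^ 2 - ‖y + s • EuclideanSpace.single j (1:ℝ) - x0‖ ^ 2) ^ (k + 2)
      * ∑ i, dq u h i (y + s • EuclideanSpace.single j (1:ℝ)) ^ 2) 0 := by
    intro j
    have hcont : ContinuousAt (fun s : ℝ => y + s • EuclideanSpace.single j (1:ℝ)) 0 := by fun_prop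
    have h0 : y + (0:ℝ) • EuclideanSpace.single j (1:ℝ) = y := by simp
    have : IsLocalMax (fun z => (r ^ 2 - ‖z - x0‖ ^ 2) ^ (k + 2) * ∑ i, dq u h i z ^ 2)
      (y + (0:ℝ) • EuclideanSpace.single j (1:ℝ)) := by rw [h0]; exact hm
    exact hcont.tendsto.eventually this
  refine ⟨fun j => ((key j).max (hmax j)).1, ?_⟩
  have hsum := Finset.sum_nonpos (s := Finset.univ) fun j _ => ((key j).max (hmax j)).2
  refine le_trans (le_of_eq ?_) hsum
  have hlap : ∀ i, ∑ j, T i j =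
      -(h⁻¹ • (‖gradient u (y + h • EuclideanSpace.single i 1)‖ ^ p - ‖gradient u y‖ ^ p)) := by
    intro i
    rw [hT, ← Finset.mul_sum, Finset.sum_sub_distrib, ← laplacian_eq, ← laplacian_eq,
      ← heq _ hy, ← heq _ (hyi i), smul_eq_mul]
    ring
  have e1 : ∑ j, ∑ i, 2 * dq u h i y * T i j = ∑ i, 2 * dq u h i y *
      (-(h⁻¹ • (‖gradient u (y + h • EuclideanSpace.single i 1)‖ ^ p - ‖gradient u y‖ ^ p))) := by
    rw [Finset.sum_comm]
    refine Finset.sum_congr rfl fun i _ => ?_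
    rw [← Finset.mul_sum, hlap]
  have e2 : ∑ j, q ^ (k+2) * ∑ i, (2 * Lv i j ^ 2 + 2 * dq u h i y * T i j)
      = ∑ j, q ^ (k+2) * ∑ i, 2 * Lv i j ^ 2 - q ^ (k + 2) * ∑ i, 2 * dq u h i y *
      (h⁻¹ • (‖gradient u (y + h • EuclideanSpace.single i 1)‖ ^ p - ‖gradient u y‖ ^ p)) := by
    simp only [Finset.sum_add_distrib, mul_add]
    rw [← Finset.mul_sum (f := fun j => ∑ i, 2 * dq u h i y * T i j), e1]
    simp only [mul_neg, Finset.sum_neg_distrib]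
    ring
  rw [Finset.sum_add_distrib (g := fun j => q ^ (k+2) * ∑ i, (2 * Lv i j ^ 2 + 2 * dq u h i y * T i j)), e2]
  rw [Finset.sum_add_distrib (g := fun j => q ^ (k+2) * ∑ i, 2 * Lv i j ^ 2)]
  ring


lemma bernstein_limit {d : ℕ} {u : EuclideanSpace ℝ (Fin d) → ℝ} {r p : ℝ} (k : ℕ)
    {x0 : EuclideanSpace ℝ (Fin d)} {U : Set (EuclideanSpace ℝ (Fin d))}
    (hU : IsOpen U) (hu : ContDiffOn ℝ 2 u U)
    (heq : ∀ x ∈ U, -laplacian u x = ‖gradient u x‖ ^ p)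
    (hr : 0 < r) (hsub : Metric.closedBall x0 r ⊆ U)
    (hw0 : 0 < ∑ i, (fderiv ℝ u x0 (EuclideanSpace.single i 1)) ^ 2) :
    ∃ y ∈ Metric.ball x0 r, ∃ f : Fin d → ℝ, ∃ B : Fin d → Fin d → ℝ,
      (∀ i j, B i j = B j i) ∧ (0 < ∑ i, f i ^ 2) ∧
      ((r ^ 2) ^ (k + 2) * ∑ i, (fderiv ℝ u x0 (EuclideanSpace.single i 1)) ^ 2 ≤
        (r ^ 2 - ‖y - x0‖ ^ 2) ^ (k + 2) * ∑ i, f i ^ 2) ∧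
      (∑ i, B i i = - (∑ i, f i ^ 2) ^ (p / 2)) ∧
      (∀ j, ((k + 2) * (r ^ 2 - ‖y - x0‖ ^ 2) ^ (k + 1) * (-2 * (y - x0) j)) * (∑ i, f i ^ 2)
      + (r ^ 2 - ‖y - x0‖ ^ 2) ^ (k + 2) * ∑ i, 2 * f i * B i j = 0) ∧
      (∑ j, (((k + 2) * (k + 1) * (r ^ 2 - ‖y - x0‖ ^ 2) ^ k * (-2 * (y - x0) j) ^ 2 +
        (k + 2) * (r ^ 2 - ‖y - x0‖ ^ 2) ^ (k + 1) * (-2)) * (∑ i, f i ^ 2)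
      + 2 * ((k + 2) * (r ^ 2 - ‖y - x0‖ ^ 2) ^ (k + 1) * (-2 * (y - x0) j)) *
        (∑ i, 2 * f i * B i j)
      + (r ^ 2 - ‖y - x0‖ ^ 2) ^ (k + 2) * ∑ i, 2 * (B i j) ^ 2)
      - (r ^ 2 - ‖y - x0‖ ^ 2) ^ (k + 2) * ∑ i, 2 * f i *
        (p / 2 * (∑ i, f i ^ 2) ^ (p / 2 - 1) * ∑ l, 2 * f l * B i l) ≤ 0) := by
  have hc : ∀ z ∈ U, ContDiffAt ℝ 2 u z := fun z hz => hu.contDiffAt (hU.mem_nhds hz)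
  have hK : IsCompact (Metric.closedBall x0 r) := isCompact_closedBall x0 r
  obtain ⟨δ, hδ, hδU⟩ := hK.exists_cthickening_subset_open hU hsub
  set h : ℕ → ℝ := fun m => δ / (m + 1) with hh
  have hpos : ∀ m, 0 < h m := fun m => by positivity
  have hle : ∀ m, h m ≤ δ := fun m => by
    rw [hh]; simp only
    rw [div_le_iff₀ (by positivity)]
    have : (0:ℝ) ≤ m := by positivity
    nlinarith
  have hlim : Tendsto h atTop (𝓝 0) := by
    have := (tendsto_one_div_add_atTop_nhds_zero_nat (𝕜 := ℝ)).const_mul δ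
    simpa [hh, div_eq_mul_inv] using this
  have hshift : ∀ m, ∀ y ∈ Metric.closedBall x0 r, ∀ i, y + h m • EuclideanSpace.single i (1:ℝ) ∈ U := by
    intro m y hy i
    apply hδU
    apply Metric.mem_cthickening_of_dist_le _ y _ _ hy
    rw [dist_eq_norm, add_sub_cancel_left, norm_smul]
    simpa [abs_of_pos (hpos m)] using hle m
  have hcontW : ∀ m, ContinuousOn
      (fun z => (r ^ 2 - ‖z - x0‖ ^ 2) ^ (k + 2) * ∑ i, dq u (h m) i z ^ 2) (Metric.closedBall x0 r) := by
    intro m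
    apply ContinuousOn.mul
    · fun_prop
    · refine continuousOn_finsetSum _ fun i _ => ?_
      apply ContinuousOn.pow
      unfold dq
      apply continuousOn_const.mul
      apply ContinuousOn.sub
      · exact hu.continuousOn.comp (by fun_prop) (fun y hy => hshift m y hy i)
      · exact hu.continuousOn.mono hsub
  have hx0 : x0 ∈ Metric.closedBall x0 r := Metric.mem_closedBall_self hr.le
  have hex : ∀ m, ∃ y ∈ Metric.closedBall x0 r, IsMaxOn
      (fun z => (r ^ 2 - ‖z - x0‖ ^ 2) ^ (k + 2) * ∑ i, dq u (h m) i z ^ 2) (Metric.closedBall x0 r) y :=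
    fun m => hK.exists_isMaxOn ⟨x0, hx0⟩ (hcontW m)
  choose Y hYmem hYmax using hex
  obtain ⟨y, hy, φ, hφ, hYy⟩ := hK.tendsto_subseq hYmem
  have hh2 : Tendsto (fun m => h (φ m)) atTop (𝓝 0) := hlim.comp hφ.tendsto_atTop
  have hne : ∀ m, h (φ m) ≠ 0 := fun m => (hpos _).ne'
  have hdq : ∀ (z : ℕ → EuclideanSpace ℝ (Fin d)) z0, z0 ∈ U → Tendsto z atTop (𝓝 z0) →
      ∀ i, Tendsto (fun m => dq u (h (φ m)) i (z m)) atTop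
        (𝓝 (fderiv ℝ u z0 (EuclideanSpace.single i 1))) := by
    intro z z0 hz0 hz i
    have := diffquot_tendsto ((hc z0 hz0).hasStrictFDerivAt (by norm_num)) hz hh2 hne
      (EuclideanSpace.single i 1)
    simpa [dq] using this
  have hyU := hsub hy
  have hq : Tendsto (fun m => r ^ 2 - ‖Y (φ m) - x0‖ ^ 2) atTop (𝓝 (r ^ 2 - ‖y - x0‖ ^ 2)) :=
    tendsto_const_nhds.sub ((hYy.sub tendsto_const_nhds).norm.pow 2)
  have hdqY := hdq _ y hyU hYy
  have hwY : Tendsto (fun m => ∑ i, dq u (h (φ m)) i (Y (φ m)) ^ 2) atTop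
      (𝓝 (∑ i, (fderiv ℝ u y (EuclideanSpace.single i 1)) ^ 2)) :=
    tendsto_finsetSum _ fun i _ => (hdqY i).pow 2
  have hA : (r ^ 2) ^ (k + 2) * ∑ i, (fderiv ℝ u x0 (EuclideanSpace.single i 1)) ^ 2 ≤
        (r ^ 2 - ‖y - x0‖ ^ 2) ^ (k + 2) * ∑ i, (fderiv ℝ u y (EuclideanSpace.single i 1)) ^ 2 := by
    have l1 : Tendsto (fun m => (r ^ 2) ^ (k + 2) * ∑ i, dq u (h (φ m)) i x0 ^ 2) atTop
        (𝓝 ((r ^ 2) ^ (k + 2) * ∑ i, (fderiv ℝ u x0 (EuclideanSpace.single i 1)) ^ 2)) :=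
      tendsto_const_nhds.mul (tendsto_finsetSum _ fun i _ =>
        (hdq (fun _ => x0) x0 (hsub hx0) tendsto_const_nhds i).pow 2)
    refine le_of_tendsto_of_tendsto' l1 ((hq.pow (k+2)).mul hwY) fun m => ?_
    have := hYmax (φ m) hx0
    simpa using this
  have hlhs : 0 < (r ^ 2) ^ (k + 2) * ∑ i, (fderiv ℝ u x0 (EuclideanSpace.single i 1)) ^ 2 := by
    positivity
  have hynorm : ‖y - x0‖ ≤ r := by simpa [dist_eq_norm] using hy
  have hyball : y ∈ Metric.ball x0 r := by
    rw [Metric.mem_ball, dist_eq_norm]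
    refine lt_of_le_of_ne hynorm fun hcon => ?_
    rw [hcon, sub_self, zero_pow (by omega), zero_mul] at hA
    linarith
  have hwy : 0 < ∑ i, (fderiv ℝ u y (EuclideanSpace.single i 1)) ^ 2 := by
    refine lt_of_le_of_ne (by positivity) fun hcon => ?_
    rw [← hcon] at hA
    simp only [mul_zero] at hA
    linarith
  obtain ⟨G, hG, hGv⟩ := grad_pow_strict p (hc y hyU) hwy
  have hDu : HasStrictFDerivAt (fderiv ℝ u) (fderiv ℝ (fderiv ℝ u) y) y :=
    ((hc y hyU).fderiv_right (m := 1) (by norm_num)).hasStrictFDerivAt (by norm_num)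
  have hev : ∀ᶠ m in atTop, Y (φ m) ∈ Metric.ball x0 r :=
    hYy.eventually (Metric.isOpen_ball.mem_nhds hyball)
  have hdisc : ∀ᶠ m in atTop, _ := hev.mono fun m hm =>
    bernstein_discrete (h := h (φ m)) (p := p) (k := k) hU hu heq (hsub (hYmem _)) (hshift _ _ (hYmem _))
      ((hYmax (φ m)).isLocalMax (mem_of_superset (Metric.isOpen_ball.mem_nhds hm)
        Metric.ball_subset_closedBall))
  have hL : ∀ i j, Tendsto (fun m => ((h (φ m))⁻¹ • (fderiv ℝ u (Y (φ m) + h (φ m) •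
      EuclideanSpace.single i 1) - fderiv ℝ u (Y (φ m)))) (EuclideanSpace.single j 1)) atTop
      (𝓝 (fderiv ℝ (fderiv ℝ u) y (EuclideanSpace.single i 1) (EuclideanSpace.single j 1))) := by
    intro i j
    have := diffquot_tendsto hDu hYy hh2 hne (EuclideanSpace.single i 1)
    exact ((ContinuousLinearMap.apply ℝ ℝ (EuclideanSpace.single j (1:ℝ))).continuous.tendsto _).comp
      this
  have hGl : ∀ i, Tendsto (fun m => (h (φ m))⁻¹ • (‖gradient u (Y (φ m) + h (φ m) •
      EuclideanSpace.single i 1)‖ ^ p - ‖gradient u (Y (φ m))‖ ^ p)) atTop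
      (𝓝 (G (EuclideanSpace.single i 1))) := fun i =>
    diffquot_tendsto hG hYy hh2 hne (EuclideanSpace.single i 1)
  have hcoord : ∀ j, Tendsto (fun m => (Y (φ m) - x0) j) atTop (𝓝 ((y - x0) j)) := by
    intro j
    have : Continuous (fun z : EuclideanSpace ℝ (Fin d) => (z - x0) j) := by fun_prop
    exact (this.tendsto y).comp hYy
  refine ⟨y, hyball, fun i => fderiv ℝ u y (EuclideanSpace.single i 1), fun i j =>
    fderiv ℝ (fderiv ℝ u) y (EuclideanSpace.single i 1) (EuclideanSpace.single j 1), ?_, hwy, hA,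
    ?_, ?_, ?_⟩
  · intro i j
    exact ((hc y hyU).isSymmSndFDerivAt (by simp)) _ _
  · rw [← laplacian_eq, ← gradient_norm_sq]
    have := heq y hyU
    rw [← Real.rpow_natCast, ← Real.rpow_mul (norm_nonneg _)]
    have e : ((2:ℕ):ℝ) * (p / 2) = p := by push_cast; ring
    rw [e, ← this]; ring
  · intro j
    have l := (((tendsto_const_nhds (x := ((k:ℝ)+2))).mul (hq.pow (k+1))).mul
      ((hcoord j).const_mul (-2))).mul hwY |>.add ((hq.pow (k+2)).mul
        (tendsto_finsetSum Finset.univ fun i _ => ((hdqY i).const_mul 2).mul (hL i j)))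
    refine tendsto_nhds_unique_of_eventuallyEq l (tendsto_const_nhds) ?_
    filter_upwards [hdisc] with m hm
    exact hm.1 j
  · have hS : ∀ j, Tendsto _ atTop _ := fun j =>
      (tendsto_finsetSum Finset.univ fun i _ => ((hdqY i).const_mul 2).mul (hL i j))
    have hS2 : ∀ j, Tendsto _ atTop _ := fun j =>
      (tendsto_finsetSum Finset.univ fun i _ => ((hL i j).pow 2).const_mul 2)
    have hz1 : ∀ j, Tendsto _ atTop _ := fun j => ((tendsto_const_nhds (x := ((k:ℝ)+2))).mul (hq.pow (k+1))).mul
      ((hcoord j).const_mul (-2))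
    have hz2 : ∀ j, Tendsto _ atTop _ := fun j =>
      (((tendsto_const_nhds (x := ((k:ℝ)+2) * (k+1))).mul (hq.pow k)).mul
      (((hcoord j).const_mul (-2)).pow 2)).add
        (((tendsto_const_nhds (x := ((k:ℝ)+2))).mul (hq.pow (k+1))).mul (tendsto_const_nhds (x := (-2:ℝ))))
    have l := (tendsto_finsetSum Finset.univ fun j _ =>
      (((hz2 j).mul hwY).add (((hz1 j).const_mul 2).mul (hS j))).add ((hq.pow (k+2)).mul (hS2 j))).sub
      ((hq.pow (k+2)).mul (tendsto_finsetSum Finset.univ fun i _ => ((hdqY i).const_mul 2).mul (hGl i)))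
    simp only [hGv] at l
    refine le_of_tendsto l ?_
    filter_upwards [hdisc] with m hm
    exact hm.2


lemma bernstein_algebra {d : ℕ} (hd : 0 < d) {p r q : ℝ} (hp : 1 < p) (k : ℕ) (hr : 0 < r) (hq : 0 < q)
    (hqr : q ≤ r ^ 2) (a f : Fin d → ℝ) (B : Fin d → Fin d → ℝ) (hB : ∀ i j, B i j = B j i)
    (ha : ∑ j, a j ^ 2 ≤ r ^ 2) (hw : 0 < ∑ i, f i ^ 2)
    (hlap : ∑ i, B i i = - (∑ i, f i ^ 2) ^ (p / 2))
    (h1 : ∀ j, ((k + 2) * q ^ (k + 1) * (-2 * a j)) * (∑ i, f i ^ 2)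
      + q ^ (k + 2) * ∑ i, 2 * f i * B i j = 0)
    (h2 : ∑ j, (((k + 2) * (k + 1) * q ^ k * (-2 * a j) ^ 2 +
        (k + 2) * q ^ (k + 1) * (-2)) * (∑ i, f i ^ 2)
      + 2 * ((k + 2) * q ^ (k + 1) * (-2 * a j)) * (∑ i, 2 * f i * B i j)
      + q ^ (k + 2) * ∑ i, 2 * (B i j) ^ 2)
      - q ^ (k + 2) * ∑ i, 2 * f i *
        (p / 2 * (∑ i, f i ^ 2) ^ (p / 2 - 1) * ∑ l, 2 * f l * B i l) ≤ 0) :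
    q * (∑ i, f i ^ 2) ^ ((p - 1) / 2) ≤
      (1 + d * (2 * (k + 2) * d + 8 * (k + 2) ^ 2 + 2 * p * (k + 2))) * r := by
  set w := ∑ i, f i ^ 2 with hwdef
  set κ : ℝ := (k:ℝ) + 2 with hκ
  have hκ0 : 0 ≤ (k:ℝ) := by positivity
  have hqk : 0 < q ^ k := by positivity
  have hS : ∀ j, q * ∑ i, 2 * f i * B i j = 2 * κ * a j * w := by
    intro j
    have : q ^ (k+1) * (q * ∑ i, 2 * f i * B i j) = q ^ (k+1) * (2 * κ * a j * w) := by
      have := h1 j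
      rw [pow_succ q (k+1)] at this
      linear_combination this
    exact mul_left_cancel₀ (by positivity) this
  have hS' : ∀ j, q * ∑ l, 2 * f l * B j l = 2 * κ * a j * w := by
    intro j
    rw [← hS j]
    congr 1
    exact Finset.sum_congr rfl fun l _ => by rw [hB j l]
  have hwp : w * w ^ (p / 2 - 1) = w ^ (p / 2) := by
    rw [Real.rpow_sub hw, Real.rpow_one]; field_simp
  set A2 := ∑ j, a j ^ 2 with hA2
  set FA := ∑ i, f i * a i with hFA
  set B2 := ∑ j, ∑ i, B i j ^ 2 with hB2
  have h3 : q ^ k * (w * (4 * κ * (κ - 1) * A2 - 2 * κ * d * q) - 8 * κ ^ 2 * A2 * w + 2 * q ^ 2 * B2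
      - 2 * p * κ * w ^ (p / 2) * q * FA) ≤ 0 := by
    refine le_trans (le_of_eq ?_) h2
    have e1 : ∀ j, (κ * (k + 1) * q ^ k * (-2 * a j) ^ 2 +
        κ * q ^ (k + 1) * (-2)) * w
      + 2 * (κ * q ^ (k + 1) * (-2 * a j)) * (∑ i, 2 * f i * B i j)
      + q ^ (k + 2) * ∑ i, 2 * (B i j) ^ 2 =
      q ^ k * (w * 4 * κ * (κ - 1)) * a j ^ 2 - q ^ k * (w * (2 * κ * q)) - q ^ k * (8 * κ ^ 2 * w) * a j ^ 2
        + q ^ k * (2 * q ^ 2) * ∑ i, B i j ^ 2 := by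
      intro j
      rw [← Finset.mul_sum]
      have : (k:ℝ) + 1 = κ - 1 := by rw [hκ]; ring
      rw [this]
      have := hS j
      linear_combination (-4 * κ * q ^ k * a j) * this
    have e2 : ∀ i, 2 * f i * (p / 2 * w ^ (p / 2 - 1) * ∑ l, 2 * f l * B i l) * q =
        2 * p * κ * w ^ (p / 2) * (f i * a i) := by
      intro i
      rw [← hwp]
      linear_combination (2 * f i * (p / 2 * w ^ (p / 2 - 1))) * hS' i
    have e3 : q ^ (k + 2) * ∑ i, 2 * f i * (p / 2 * w ^ (p / 2 - 1) * ∑ l, 2 * f l * B i l)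
      = q ^ k * (2 * p * κ * w ^ (p / 2) * q * FA) := by
      have : ∑ i, 2 * f i * (p / 2 * w ^ (p / 2 - 1) * ∑ l, 2 * f l * B i l) * q =
          2 * p * κ * w ^ (p / 2) * FA := by
        rw [hFA, Finset.mul_sum]
        exact Finset.sum_congr rfl fun i _ => e2 i
      rw [← Finset.sum_mul] at this
      linear_combination (q ^ (k+1)) * this
    rw [e3, Finset.sum_congr rfl fun j _ => e1 j]
    simp only [Finset.sum_add_distrib, Finset.sum_sub_distrib, ← Finset.mul_sum, Finset.sum_const,
      Finset.card_univ, Fintype.card_fin, nsmul_eq_mul]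
    rw [← hA2, ← hB2]
    ring
  have h4 : w * (4 * κ * (κ - 1) * A2 - 2 * κ * d * q) - 8 * κ ^ 2 * A2 * w + 2 * q ^ 2 * B2
      - 2 * p * κ * w ^ (p / 2) * q * FA ≤ 0 := by
    by_contra hcon
    push Not at hcon
    have := mul_pos hqk hcon
    linarith
  have hdpos : (0:ℝ) < d := by exact_mod_cast hd
  have h5 : w ^ p ≤ d * B2 := by
    have c1 : (∑ i, B i i) ^ 2 ≤ d * ∑ i, B i i ^ 2 := by
      have := sq_sum_le_card_mul_sum_sq (s := Finset.univ) (f := fun i => B i i)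
      simpa using this
    have c2 : ∑ i, B i i ^ 2 ≤ B2 := by
      rw [hB2]
      refine Finset.sum_le_sum fun j _ => ?_
      exact Finset.single_le_sum (f := fun i => B i j ^ 2) (fun i _ => sq_nonneg _) (Finset.mem_univ j)
    have c3 : (∑ i, B i i) ^ 2 = w ^ p := by
      rw [hlap, neg_sq, ← Real.rpow_natCast, ← Real.rpow_mul hw.le]
      congr 1; push_cast; ring
    rw [← c3]
    exact c1.trans (by gcongr)
  have h6 : FA ≤ Real.sqrt w * r := by
    have c1 := Finset.sum_mul_sq_le_sq_mul_sq Finset.univ f a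
    have c2 : FA ^ 2 ≤ (Real.sqrt w * r) ^ 2 := by
      rw [mul_pow, Real.sq_sqrt hw.le]
      exact c1.trans (by gcongr)
    exact le_trans (le_abs_self _) (abs_le_of_sq_le_sq c2 (by positivity))
  set s := w ^ ((p - 1) / 2) with hs
  have hs0 : 0 < s := Real.rpow_pos_of_pos hw _
  have e1 : w ^ p = w * s ^ 2 := by
    rw [hs, ← Real.rpow_natCast, ← Real.rpow_mul hw.le]
    conv_rhs => rw [← Real.rpow_one w, ← Real.rpow_mul hw.le, ← Real.rpow_add hw]
    congr 1; push_cast; ring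
  have e2 : w ^ (p / 2) * Real.sqrt w = w * s := by
    rw [hs, Real.sqrt_eq_rpow, ← Real.rpow_add hw]
    conv_rhs => rw [← Real.rpow_one w, ← Real.rpow_mul hw.le, ← Real.rpow_add hw]
    congr 1; ring
  have hA20 : 0 ≤ A2 := by positivity
  have hκ2 : 2 ≤ κ := by rw [hκ]; linarith
  have h7 : 2 * q ^ 2 * (w * s ^ 2) ≤ d * (w * r ^ 2 * (2 * κ * d + 8 * κ ^ 2) + 2 * p * κ * q * r * (w * s)) := by
    have c1 : 2 * q ^ 2 * B2 ≤ w * r ^ 2 * (2 * κ * d + 8 * κ ^ 2) + 2 * p * κ * q * r * (w * s) := by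
      have t1 : 2 * p * κ * w ^ (p / 2) * q * FA ≤ 2 * p * κ * w ^ (p / 2) * q * (Real.sqrt w * r) := by
        gcongr
      have t2 : 2 * p * κ * w ^ (p / 2) * q * (Real.sqrt w * r) = 2 * p * κ * q * r * (w * s) := by
        rw [← e2]; ring
      have t3 : w * (2 * κ * d * q) ≤ w * (2 * κ * d * r ^ 2) := by gcongr
      have t4 : 8 * κ ^ 2 * A2 * w ≤ 8 * κ ^ 2 * r ^ 2 * w := by gcongr
      have t5 : 0 ≤ w * (4 * κ * (κ - 1) * A2) := by
        have : 0 ≤ κ - 1 := by linarith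
        positivity
      linarith
    calc 2 * q ^ 2 * (w * s ^ 2) = 2 * q ^ 2 * w ^ p := by rw [e1]
      _ ≤ 2 * q ^ 2 * (d * B2) := by gcongr
      _ = d * (2 * q ^ 2 * B2) := by ring
      _ ≤ _ := by gcongr
  set X := q * s with hX
  have hX0 : 0 < X := by positivity
  have h8 : 2 * X ^ 2 ≤ d * (r ^ 2 * (2 * κ * d + 8 * κ ^ 2) + 2 * p * κ * r * X) := by
    have : w * (2 * X ^ 2) ≤ w * (d * (r ^ 2 * (2 * κ * d + 8 * κ ^ 2) + 2 * p * κ * r * X)) := by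
      rw [hX]; linarith
    exact le_of_mul_le_mul_left this hw
  by_cases hc : X ≤ r
  · refine hc.trans ?_
    have : 0 ≤ d * (2 * κ * d + 8 * κ ^ 2 + 2 * p * κ) * r := by positivity
    linarith
  · push Not at hc
    have h9 : r ^ 2 * (2 * κ * d + 8 * κ ^ 2) ≤ r * X * (2 * κ * d + 8 * κ ^ 2) := by
      have : r ^ 2 ≤ r * X := by rw [sq]; exact mul_le_mul_of_nonneg_left hc.le hr.le
      gcongr
    have h10 : X * (2 * X) ≤ X * (d * (2 * κ * d + 8 * κ ^ 2 + 2 * p * κ) * r) := by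
      have : d * (r ^ 2 * (2 * κ * d + 8 * κ ^ 2) + 2 * p * κ * r * X) ≤
        d * (r * X * (2 * κ * d + 8 * κ ^ 2) + 2 * p * κ * r * X) := by gcongr
      linarith
    have h11 := le_of_mul_le_mul_left h10 hX0
    linarith

lemma gradient_bound {d : ℕ} (hd : 0 < d) {p : ℝ} (hp : 1 < p) : ∃ C : ℝ, 0 < C ∧
    ∀ (u : EuclideanSpace ℝ (Fin d) → ℝ) (U : Set (EuclideanSpace ℝ (Fin d))), IsOpen U →
      ContDiffOn ℝ 2 u U → (∀ x ∈ U, -laplacian u x = ‖gradient u x‖ ^ p) →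
      ∀ (x0 : EuclideanSpace ℝ (Fin d)) (r : ℝ), 0 < r → Metric.closedBall x0 r ⊆ U →
        ‖gradient u x0‖ ≤ C * r ^ (-(1 / (p - 1))) := by
  obtain ⟨k, hk⟩ := exists_nat_ge (2 / (p - 1))
  have hp0 : 0 < p - 1 := by linarith
  set m := 2 / (p - 1) with hm
  have hm0 : 0 < m := by positivity
  set C := 1 + d * (2 * (k + 2) * d + 8 * (k + 2) ^ 2 + 2 * p * (k + 2)) with hC
  have hCpos : 0 < C := by positivity
  refine ⟨C ^ (m / 2), by positivity, ?_⟩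
  intro u U hU hu heq x0 r hr hsub
  by_cases hw0 : 0 < ∑ i, (fderiv ℝ u x0 (EuclideanSpace.single i 1)) ^ 2
  swap
  · rw [← gradient_norm_sq] at hw0
    have : ‖gradient u x0‖ = 0 := by
      by_contra hne
      exact hw0 (by positivity)
    rw [this]; positivity
  obtain ⟨y, hy, f, B, hB, hw, hA, hlap, h1, h2⟩ := bernstein_limit k hU hu heq hr hsub hw0
  have hyn : ‖y - x0‖ < r := by simpa [dist_eq_norm] using hy
  set q := r ^ 2 - ‖y - x0‖ ^ 2 with hq
  have hq0 : 0 < q := by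
    have := norm_nonneg (y - x0)
    rw [hq]; nlinarith [norm_nonneg (y - x0)]
  have hqr : q ≤ r ^ 2 := by rw [hq]; nlinarith [sq_nonneg ‖y - x0‖]
  have ha : ∑ j, (y - x0) j ^ 2 ≤ r ^ 2 := by
    have : ‖y - x0‖ ^ 2 = ∑ j, (y - x0) j ^ 2 := by
      rw [EuclideanSpace.norm_sq_eq]; simp
    rw [← this]; gcongr
  have key := bernstein_algebra hd hp k hr hq0 hqr (fun j => (y - x0) j) f B hB ha hw hlap h1 h2
  rw [← hC] at key
  rw [← gradient_norm_sq] at hA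
  set w := ∑ i, f i ^ 2 with hwd
  have k1 : q ^ m * w ≤ C ^ m * r ^ m := by
    have := Real.rpow_le_rpow (by positivity) key hm0.le
    rw [Real.mul_rpow hq0.le (by positivity), Real.mul_rpow hCpos.le hr.le, ← Real.rpow_mul hw.le] at this
    have e : (p - 1) / 2 * m = 1 := by rw [hm]; field_simp
    rwa [e, Real.rpow_one] at this
  have k2 : q ^ (k + 2) ≤ q ^ m * (r ^ 2) ^ ((k:ℝ) + 2 - m) := by
    have : q ^ (k + 2) = q ^ m * q ^ ((k:ℝ) + 2 - m) := by
      rw [← Real.rpow_add hq0, ← Real.rpow_natCast]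
      congr 1; push_cast; ring
    rw [this]
    gcongr
    linarith
  have k3 : (r ^ 2) ^ (k + 2) * ‖gradient u x0‖ ^ 2 ≤ (r ^ 2) ^ ((k:ℝ) + 2 - m) * (C ^ m * r ^ m) := by
    calc _ ≤ q ^ (k + 2) * w := hA
      _ ≤ q ^ m * (r ^ 2) ^ ((k:ℝ) + 2 - m) * w := by gcongr
      _ = (r ^ 2) ^ ((k:ℝ) + 2 - m) * (q ^ m * w) := by ring
      _ ≤ _ := by gcongr
  have e1 : (r ^ 2) ^ ((k:ℝ) + 2 - m) * (C ^ m * r ^ m) =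
      (r ^ 2) ^ (k + 2) * (C ^ (m / 2) * r ^ (-(1 / (p - 1)))) ^ 2 := by
    have e2 : (r ^ 2) ^ ((k:ℝ) + 2 - m) = (r ^ 2) ^ (k + 2) * r ^ (-(2 * m)) := by
      rw [Real.rpow_sub (by positivity)]
      have : (r ^ 2) ^ ((k:ℝ) + 2) = (r ^ 2) ^ (k + 2) := by
        rw [← Real.rpow_natCast (r ^ 2) (k + 2)]; push_cast; rfl
      rw [this, div_eq_mul_inv, ← Real.rpow_neg (by positivity), ← Real.rpow_natCast r 2,
        ← Real.rpow_mul hr.le (2:ℕ) (-m)]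
      congr 2; push_cast; ring
    have e3 : (C ^ (m / 2)) ^ 2 = C ^ m := by
      rw [← Real.rpow_natCast, ← Real.rpow_mul hCpos.le]; congr 1; push_cast; ring
    have e4 : (r ^ (-(1 / (p - 1)))) ^ 2 = r ^ (-m) := by
      rw [← Real.rpow_natCast, ← Real.rpow_mul hr.le]; congr 1; push_cast; rw [hm]; ring
    have e5 : r ^ (-(2 * m)) * r ^ m = r ^ (-m) := by
      rw [← Real.rpow_add hr]; congr 1; ring
    rw [e2, mul_pow, e3, e4, ← e5]; ring
  rw [e1] at k3
  have k4 := le_of_mul_le_mul_left k3 (by positivity)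
  exact (abs_le_of_sq_le_sq' k4 (by positivity)).2


lemma isOpen_halfSpace (n : ℕ) : IsOpen (halfSpace n) := by
  unfold halfSpace
  exact isOpen_lt continuous_const (by fun_prop)

lemma coord_le_norm {d : ℕ} (x : EuclideanSpace ℝ (Fin d)) (i : Fin d) : |x i| ≤ ‖x‖ := by
  simpa using PiLp.norm_apply_le x i

lemma growth_bound {n : ℕ} {p : ℝ} (hp1 : 1 < p) (hp2 : p < 2)
    (u : EuclideanSpace ℝ (Fin (n + 1)) → ℝ)
    (hu2 : ContDiffOn ℝ 2 u (halfSpace n))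
    (heq : ∀ x ∈ halfSpace n, -laplacian u x = ‖gradient u x‖ ^ p) :
    ∃ C : ℝ, 0 < C ∧ ∀ x : EuclideanSpace ℝ (Fin (n + 1)),
        0 < x (Fin.last n) → x (Fin.last n) ≤ 1 →
          |u x| ≤ C * x (Fin.last n) ^ (-((2 - p) / (p - 1))) := by
  have hp0 : 0 < p - 1 := by linarith
  set b := 1 / (p - 1) with hb
  set β := (2 - p) / (p - 1) with hβ
  have hβ0 : 0 < β := div_pos (by linarith) hp0
  have hbβ : b = β + 1 := by rw [hb, hβ]; field_simp; ring
  obtain ⟨C1, hC1, hgrad⟩ := gradient_bound (d := n + 1) (by omega) hp1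
  set e : EuclideanSpace ℝ (Fin (n + 1)) := EuclideanSpace.single (Fin.last n) 1 with he
  have hen : e (Fin.last n) = 1 := by simp [he]
  set C2 := C1 * (1 / 2 : ℝ) ^ (-b) with hC2
  have hC2p : 0 < C2 := by positivity
  have hdiff : ∀ x, 0 < x (Fin.last n) → DifferentiableAt ℝ u x := fun x hx =>
    (hu2.contDiffAt ((isOpen_halfSpace n).mem_nhds hx)).differentiableAt (by norm_num)
  have hD : ∀ x, 0 < x (Fin.last n) → ‖fderiv ℝ u x‖ ≤ C2 * x (Fin.last n) ^ (-b) := by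
    intro x hx
    rw [norm_fderiv_eq]
    have := hgrad u (halfSpace n) (isOpen_halfSpace n) hu2 heq x (x (Fin.last n) * (1 / 2)) (by positivity) ?_
    · rw [Real.mul_rpow hx.le (by norm_num)] at this
      rw [hC2]; linarith
    · intro y hy
      have h1 : ‖y - x‖ ≤ x (Fin.last n) * (1 / 2) := by simpa [dist_eq_norm] using hy
      have h2 := (coord_le_norm (y - x) (Fin.last n)).trans h1
      have h3 := (abs_le.1 h2).1
      simp at h3
      show 0 < y (Fin.last n)
      linarith
  set C3 := C2 / β with hC3
  have hC3p : 0 < C3 := by positivity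
  have hvert : ∀ x, 0 < x (Fin.last n) → ∀ s : ℝ, 0 ≤ s →
      |u (x + s • e) - u x| ≤ C3 * x (Fin.last n) ^ (-β) := by
    intro x hx s hs
    set t := x (Fin.last n) with ht
    have hht : ∀ z : ℝ, (x + z • e) (Fin.last n) = t + z := fun z => by simp [hen, ht]
    have hf' : ∀ z : ℝ, 0 ≤ z → HasDerivAt (fun z : ℝ => u (x + z • e) - u x) (fderiv ℝ u (x + z • e) e) z := by
      intro z hz
      have h1 : HasDerivAt (fun z : ℝ => x + z • e) e z := by
        simpa using ((hasDerivAt_id z).smul_const e).const_add x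
      have h2 := (hdiff (x + z • e) (by rw [hht]; linarith)).hasFDerivAt
      exact (h2.comp_hasDerivAt z h1).sub_const _
    have hB' : ∀ z : ℝ, 0 ≤ z → HasDerivAt (fun z : ℝ => C3 * (t ^ (-β) - (t + z) ^ (-β)))
        (C2 * (t + z) ^ (-b)) z := by
      intro z hz
      have h1 : HasDerivAt (fun z : ℝ => t + z) 1 z := (hasDerivAt_id z).const_add t
      have h2 := ((h1.rpow_const (p := -β) (Or.inl (by positivity))).const_sub (t ^ (-β))).const_mul C3
      refine h2.congr_deriv ?_
      have : -β - 1 = -b := by rw [hbβ]; ring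
      rw [this, hC3]; field_simp
    have := image_norm_le_of_norm_deriv_right_le_deriv_boundary' (a := 0) (b := s)
      (f := fun z : ℝ => u (x + z • e) - u x) (f' := fun z => fderiv ℝ u (x + z • e) e)
      (B := fun z : ℝ => C3 * (t ^ (-β) - (t + z) ^ (-β))) (B' := fun z => C2 * (t + z) ^ (-b))
      (fun z hz => (hf' z hz.1).continuousAt.continuousWithinAt)
      (fun z hz => (hf' z hz.1).hasDerivWithinAt) (by simp)
      (fun z hz => (hB' z hz.1).continuousAt.continuousWithinAt)
      (fun z hz => (hB' z hz.1).hasDerivWithinAt) ?_ (right_mem_Icc.2 hs)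
    · rw [Real.norm_eq_abs] at this
      refine this.trans ?_
      have : 0 ≤ (t + s) ^ (-β) := by positivity
      gcongr
      linarith
    · intro z hz
      have h1 := hD (x + z • e) (by rw [hht]; linarith [hz.1])
      rw [hht] at h1
      refine le_trans ((fderiv ℝ u (x + z • e)).le_opNorm e) ?_
      have : ‖e‖ = 1 := by simp [he]
      rw [this, mul_one]; exact h1
  refine ⟨2 * C3 + C2 + |u e|, by positivity, ?_⟩
  intro x hx hx1
  set t := x (Fin.last n) with ht
  set T := 1 + 2 * ‖x‖ with hT
  have hT1 : 1 ≤ T := by rw [hT]; linarith [norm_nonneg x]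
  have a1 := hvert x hx T (by linarith)
  have a3 := hvert e (by rw [hen]; norm_num) (t + T - 1) (by linarith)
  rw [hen, Real.one_rpow] at a3
  have hee : e + (t + T - 1) • e = (t + T) • e := by
    rw [sub_smul, one_smul]; abel
  rw [hee] at a3
  have a2 : |u (x + T • e) - u ((t + T) • e)| ≤ C2 := by
    have hconv : Convex ℝ {z : EuclideanSpace ℝ (Fin (n + 1)) | T ≤ z (Fin.last n)} := by
      intro y hy z hz α γ hα hγ hαγ
      have hy' : T ≤ y (Fin.last n) := hy
      have hz' : T ≤ z (Fin.last n) := hz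
      show T ≤ (α • y + γ • z) (Fin.last n)
      simp only [PiLp.add_apply, PiLp.smul_apply, smul_eq_mul]
      calc T = α * T + γ * T := by rw [← add_mul, hαγ, one_mul]
        _ ≤ _ := by gcongr
    have := hconv.norm_image_sub_le_of_norm_fderiv_le (f := u) (C := C2 * T ^ (-b))
      (x := (t + T) • e) (y := x + T • e) (fun z hz => hdiff z (lt_of_lt_of_le (by linarith) hz)) ?_ ?_ ?_
    · rw [Real.norm_eq_abs] at this
      refine this.trans ?_
      have n1 : ‖x + T • e - (t + T) • e‖ ≤ T := by
        have : x + T • e - (t + T) • e = x - t • e := by module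
        rw [this]
        refine (norm_sub_le _ _).trans ?_
        have h2 : ‖t • e‖ = |t| := by simp [norm_smul, he]
        rw [h2]
        have := coord_le_norm x (Fin.last n)
        rw [← ht] at this
        linarith
      have n2 : T ^ (-b) * T ≤ 1 := by
        have : T ^ (-b) * T = T ^ (-β) := by
          nth_rewrite 2 [← Real.rpow_one T]
          rw [← Real.rpow_add (by linarith)]
          congr 1; rw [hbβ]; ring
        rw [this]
        exact Real.rpow_le_one_of_one_le_of_nonpos hT1 (by linarith)
      calc C2 * T ^ (-b) * ‖x + T • e - (t + T) • e‖ ≤ C2 * T ^ (-b) * T := by gcongr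
        _ = C2 * (T ^ (-b) * T) := by ring
        _ ≤ C2 * 1 := by gcongr
        _ = C2 := mul_one _
    · intro z hz
      have hz' : T ≤ z (Fin.last n) := hz
      refine (hD z (by linarith)).trans ?_
      have : z (Fin.last n) ^ (-b) ≤ T ^ (-b) :=
        Real.rpow_le_rpow_of_nonpos (by linarith) hz' (by rw [hbβ]; linarith)
      gcongr
    · show T ≤ ((t + T) • e) (Fin.last n)
      simp [hen, hx.le]
    · show T ≤ (x + T • e) (Fin.last n)
      simp [hen, ← ht, hx.le]
  have ht1 : 1 ≤ t ^ (-β) := Real.one_le_rpow_of_pos_of_le_one_of_nonpos hx hx1 (by linarith)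
  have tri : |u x| ≤ |u (x + T • e) - u x| + |u (x + T • e) - u ((t + T) • e)|
      + |u ((t + T) • e) - u e| + |u e| := by
    have h1 := abs_le.1 (le_refl |u (x + T • e) - u x|)
    have h2 := abs_le.1 (le_refl |u (x + T • e) - u ((t + T) • e)|)
    have h3 := abs_le.1 (le_refl |u ((t + T) • e) - u e|)
    have h4 := abs_le.1 (le_refl |u e|)
    rw [abs_le]; constructor <;> linarith [h1.1, h1.2, h2.1, h2.2, h3.1, h3.2, h4.1, h4.2]
  have hnn := abs_nonneg (u e)
  calc |u x| ≤ C3 * t ^ (-β) + (C3 + C2 + |u e|) * 1 := by linarith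
    _ ≤ C3 * t ^ (-β) + (C3 + C2 + |u e|) * t ^ (-β) := by gcongr
    _ = _ := by ring


lemma barrier_profile (d : ℕ) {p N0 : ℝ} (hp1 : 1 < p) (hp2 : p < 2) (hN0 : 0 < N0) :
    ∃ c A : ℝ, 0 < c ∧ 0 < A ∧ 1 / c * Real.log (1 + A) = N0 ∧
      ∀ h X : ℝ, 0 ≤ h → h ≤ d + 2 → 0 ≤ X →
        (A / (c * (1 + A * h)) * X) ^ p <
          2 * (A / (c * (1 + A * h))) + c * (A / (c * (1 + A * h)) * X) ^ 2 := by
  have h2p : 0 < 2 - p := by linarith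
  set γ := p / (2 - p) - 1 with hγ
  have hγ0 : 0 < γ := by
    rw [hγ, sub_pos, lt_div_iff₀ h2p]; linarith
  have e1 := (tendsto_rpow_atTop hγ0).eventually_gt_atTop (((d:ℝ) + 3) / 2)
  obtain ⟨c, hc1, hc2, hc3⟩ := (e1.and ((eventually_gt_atTop (0:ℝ)).and
    (eventually_ge_atTop (1 / N0)))).exists
  have hcN : 1 ≤ c * N0 := by rwa [div_le_iff₀ hN0] at hc3
  set A := Real.exp (c * N0) - 1 with hA
  have hA1 : 1 ≤ A := by
    have := Real.add_one_le_exp (c * N0)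
    rw [hA]; linarith
  refine ⟨c, A, hc2, by linarith, ?_, ?_⟩
  · have : 1 + A = Real.exp (c * N0) := by rw [hA]; ring
    rw [this, Real.log_exp]; field_simp
  intro h X hh0 hh1 hX
  set P := A / (c * (1 + A * h)) with hP
  have hden : 0 < 1 + A * h := by positivity
  have hPpos : 0 < P := by positivity
  have hPlow : 1 / (c * (d + 3)) ≤ P := by
    rw [hP, div_le_div_iff₀ (by positivity) (by positivity)]
    have : 1 + A * h ≤ A * (d + 3) := by nlinarith
    nlinarith
  set Y := P * X with hY
  have hY0 : 0 ≤ Y := by positivity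
  by_cases hcase : c ^ (-(1 / (2 - p))) ≤ Y
  · have hYpos : 0 < Y := lt_of_lt_of_le (by positivity) hcase
    have h1 : c⁻¹ ≤ Y ^ (2 - p) := by
      have := Real.rpow_le_rpow (by positivity) hcase h2p.le
      rw [← Real.rpow_mul hc2.le] at this
      have e : -(1 / (2 - p)) * (2 - p) = -1 := by field_simp
      rwa [e, Real.rpow_neg_one] at this
    have h2 : Y ^ 2 = Y ^ (2 - p) * Y ^ p := by
      rw [← Real.rpow_add hYpos, ← Real.rpow_natCast]; congr 1; push_cast; ring
    have h3 : Y ^ p ≤ c * Y ^ 2 := by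
      rw [h2]
      have h4 : 1 ≤ c * Y ^ (2 - p) := by
        have := mul_le_mul_of_nonneg_left h1 hc2.le
        rwa [mul_inv_cancel₀ hc2.ne'] at this
      have h5 : 0 < Y ^ p := by positivity
      nlinarith
    linarith
  · push Not at hcase
    have h1 : Y ^ p ≤ c ^ (-(p / (2 - p))) := by
      have := Real.rpow_le_rpow hY0 hcase.le (by linarith : 0 ≤ p)
      rw [← Real.rpow_mul hc2.le] at this
      have e : -(1 / (2 - p)) * p = -(p / (2 - p)) := by ring
      rwa [e] at this
    have h2 : c ^ (-(p / (2 - p))) = (c * c ^ γ)⁻¹ := by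
      have : c * c ^ γ = c ^ (p / (2 - p)) := by
        nth_rewrite 1 [← Real.rpow_one c]
        rw [← Real.rpow_add hc2]; congr 1; rw [hγ]; ring
      rw [this, Real.rpow_neg hc2.le]
    have h3 : (c * c ^ γ)⁻¹ < 2 / (c * (d + 3)) := by
      rw [inv_lt_comm₀ (by positivity) (by positivity), inv_div]
      have : c * ((d + 3) / 2) < c * c ^ γ := by gcongr
      linarith
    have h4 : 2 / (c * ((d:ℝ) + 3)) = 2 * (1 / (c * (d + 3))) := by ring
    have h5 : 0 ≤ c * Y ^ 2 := by positivity
    rw [h2] at h1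
    linarith

/-- the quadratic function used in the barrier -/
noncomputable def barH {n : ℕ} (a : EuclideanSpace ℝ (Fin (n + 1))) (ρ : ℝ)
    (y : EuclideanSpace ℝ (Fin (n + 1))) : ℝ :=
  (‖y - a‖ ^ 2 + (n + 2) * (y (Fin.last n) * (ρ - y (Fin.last n)))) / ρ ^ 2

lemma jet_barH {n : ℕ} (a y : EuclideanSpace ℝ (Fin (n + 1))) (ρ : ℝ) (j : Fin (n + 1)) :
    ∃ Hj : ℝ, JetAt (fun s : ℝ => barH a ρ (y + s • EuclideanSpace.single j (1:ℝ))) Hj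
      ((2 - 2 * (n + 2) * (if j = Fin.last n then 1 else 0)) / ρ ^ 2) := by
  have h1 := (jet_cutoff a y 0 j).const_mul (-1)
  set δ : ℝ := if j = Fin.last n then 1 else 0 with hδ
  have h2 : JetAt (fun s : ℝ => (y + s • EuclideanSpace.single j (1:ℝ)) (Fin.last n)) δ 0 := by
    refine ⟨fun _ => δ, Eventually.of_forall fun s => ?_, rfl, hasDerivAt_const _ _⟩
    have : (fun s : ℝ => (y + s • EuclideanSpace.single j (1:ℝ)) (Fin.last n))
        = fun s => y (Fin.last n) + s * δ := by
      funext s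
      simp [hδ, Pi.single_apply, eq_comm]
    rw [this]
    simpa using ((hasDerivAt_id s).mul_const δ).const_add (y (Fin.last n))
  have h3 := h2.mul ((JetAt.const ρ).sub h2)
  have h4 := (h1.add (h3.const_mul ((n:ℝ) + 2))).const_mul (1 / ρ ^ 2)
  refine ⟨1 / ρ ^ 2 * (-1 * (-2 * (y - a) j) + ((n:ℝ) + 2) *
      (δ * (ρ - (y + (0:ℝ) • EuclideanSpace.single j (1:ℝ)) (Fin.last n)) +
        (y + (0:ℝ) • EuclideanSpace.single j (1:ℝ)) (Fin.last n) * (0 - δ))), ?_⟩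
  have hdd : δ * δ = δ := by rw [hδ]; split_ifs <;> simp
  convert h4 using 1
  · funext s; unfold barH; ring
  · linear_combination (2 * ((n:ℝ) + 2) / ρ ^ 2) * hdd

lemma barH_continuous {n : ℕ} (a : EuclideanSpace ℝ (Fin (n + 1))) (ρ : ℝ) :
    Continuous (barH a ρ) := by
  unfold barH
  fun_prop

lemma jet_log_barrier {φ : ℝ → ℝ} {a b c A : ℝ} (h : JetAt φ a b) (hc : 0 < c)
    (hpos : 0 < 1 + A * φ 0) :
    JetAt (fun s => 1 / c * Real.log (1 + A * φ s)) (A / (c * (1 + A * φ 0)) * a)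
      (-c * (A / (c * (1 + A * φ 0))) ^ 2 * a ^ 2 + A / (c * (1 + A * φ 0)) * b) := by
  refine h.comp (G := fun t => 1 / c * Real.log (1 + A * t)) (G' := fun t => A / (c * (1 + A * t)))
    ?_ ?_
  · have : ∀ᶠ t in 𝓝 (φ 0), 0 < 1 + A * t := by
      have hcont : Continuous fun t : ℝ => 1 + A * t := by fun_prop
      exact hcont.continuousAt.eventually (lt_mem_nhds hpos)
    filter_upwards [this] with t ht
    have h1 : HasDerivAt (fun t : ℝ => 1 + A * t) A t := by
      simpa using ((hasDerivAt_id t).const_mul A).const_add 1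
    refine ((h1.log ht.ne').const_mul (1 / c)).congr_deriv ?_
    field_simp
  · have h1 : HasDerivAt (fun t : ℝ => c * (1 + A * t)) (c * A) (φ 0) := by
      simpa using (((hasDerivAt_id (φ 0)).const_mul A).const_add 1).const_mul c
    have h2 := (hasDerivAt_const (φ 0) A).div h1 (by positivity)
    refine h2.congr_deriv ?_
    field_simp
    ring

lemma halfball_comparison {n : ℕ} {p : ℝ} (hp1 : 1 < p) (hp2 : p < 2)
    (f : EuclideanSpace ℝ (Fin (n + 1)) → ℝ)
    (hf2 : ContDiffOn ℝ 2 f (halfSpace n))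
    (hfc : ContinuousOn f {y | 0 ≤ y (Fin.last n)})
    (hsub : ∀ x ∈ halfSpace n, -laplacian f x ≤ ‖gradient f x‖ ^ p)
    (hf0 : ∀ x : EuclideanSpace ℝ (Fin (n + 1)), x (Fin.last n) = 0 → f x ≤ 0)
    {c A N0 N ρ : ℝ} (hc : 0 < c) (hA : 0 < A) (hN0 : 0 < N0) (hcA : 1 / c * Real.log (1 + A) = N0)
    (hbar : ∀ h X : ℝ, 0 ≤ h → h ≤ ((n + 1 : ℕ) : ℝ) + 2 → 0 ≤ X →
        (A / (c * (1 + A * h)) * X) ^ p <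
          2 * (A / (c * (1 + A * h))) + c * (A / (c * (1 + A * h)) * X) ^ 2)
    (hN : 0 < N) (hρ : 0 < ρ) (hNρ : N * ρ ^ ((2 - p) / (p - 1)) ≤ N0)
    (a : EuclideanSpace ℝ (Fin (n + 1))) (ha : a (Fin.last n) = 0)
    (hfN : ∀ y : EuclideanSpace ℝ (Fin (n + 1)), 0 ≤ y (Fin.last n) → ‖y - a‖ = ρ → f y ≤ N)
    (y : EuclideanSpace ℝ (Fin (n + 1))) (hy0 : 0 ≤ y (Fin.last n)) (hy1 : ‖y - a‖ ≤ ρ) :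
    f y ≤ N / N0 * (1 / c * Real.log (1 + A * barH a ρ y)) := by
  set K : Set (EuclideanSpace ℝ (Fin (n + 1))) :=
    {y | 0 ≤ y (Fin.last n)} ∩ Metric.closedBall a ρ with hK
  have hcl : IsClosed {y : EuclideanSpace ℝ (Fin (n + 1)) | 0 ≤ y (Fin.last n)} :=
    isClosed_le continuous_const (by fun_prop)
  have hKc : IsCompact K := (isCompact_closedBall a ρ).inter_left hcl
  have hn0 : (0:ℝ) ≤ n := Nat.cast_nonneg n
  have hcoord : ∀ z ∈ K, 0 ≤ z (Fin.last n) ∧ z (Fin.last n) ≤ ρ ∧ ‖z - a‖ ≤ ρ := by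
    intro z hz
    have h1 : ‖z - a‖ ≤ ρ := by simpa [dist_eq_norm] using hz.2
    have h2 := coord_le_norm (z - a) (Fin.last n)
    have h3 : (z - a) (Fin.last n) = z (Fin.last n) := by simp [ha]
    rw [h3] at h2
    exact ⟨hz.1, (le_abs_self _).trans (h2.trans h1), h1⟩
  have hH0 : ∀ z ∈ K, 0 ≤ barH a ρ z := by
    intro z hz
    obtain ⟨h1, h2, h3⟩ := hcoord z hz
    unfold barH
    have : 0 ≤ ρ - z (Fin.last n) := by linarith
    positivity
  have hHup : ∀ z ∈ K, barH a ρ z ≤ ((n + 1 : ℕ) : ℝ) + 2 := by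
    intro z hz
    obtain ⟨h1, h2, h3⟩ := hcoord z hz
    unfold barH
    rw [div_le_iff₀ (by positivity)]
    push_cast
    have e1 : ‖z - a‖ ^ 2 ≤ ρ ^ 2 := by gcongr
    have e2 : z (Fin.last n) * (ρ - z (Fin.last n)) ≤ ρ ^ 2 := by nlinarith
    nlinarith
  set W : EuclideanSpace ℝ (Fin (n + 1)) → ℝ :=
    fun z => N / N0 * (1 / c * Real.log (1 + A * barH a ρ z)) with hW
  have hWc : ContinuousOn W K := by
    have h1 : ContinuousOn (fun z => 1 + A * barH a ρ z) K := by
      have := barH_continuous a ρ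
      fun_prop
    have h2 := h1.log (fun z hz => by have := hH0 z hz; positivity)
    exact continuousOn_const.mul (continuousOn_const.mul h2)
  have hyK : y ∈ K := ⟨hy0, by simpa [dist_eq_norm] using hy1⟩
  obtain ⟨z, hzK, hzmax⟩ := hKc.exists_isMaxOn ⟨y, hyK⟩
    ((hfc.mono inter_subset_left).sub hWc)
  by_contra hcon
  push Not at hcon
  have hzpos : 0 < f z - W z := by
    have := hzmax hyK
    have h2 : W y < f y := hcon
    have h3 : f y - W y ≤ f z - W z := this
    linarith
  obtain ⟨hz0, hz1, hz2⟩ := hcoord z hzK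
  have hHz := hH0 z hzK
  have hHz' := hHup z hzK
  have hWz0 : 0 ≤ W z := by
    have : 0 ≤ Real.log (1 + A * barH a ρ z) := Real.log_nonneg (by nlinarith)
    rw [hW]; positivity
  have hzn : 0 < z (Fin.last n) := by
    rcases hz0.lt_or_eq with h | h
    · exact h
    · have := hf0 z h.symm; linarith
  have hzρ : ‖z - a‖ < ρ := by
    rcases hz2.lt_or_eq with h | h
    · exact h
    · exfalso
      have h1 := hfN z hz0 h
      have h2 : 1 ≤ barH a ρ z := by
        unfold barH
        rw [le_div_iff₀ (by positivity), h]
        have : 0 ≤ ρ - z (Fin.last n) := by linarith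
        have : 0 ≤ ((n:ℝ) + 2) * (z (Fin.last n) * (ρ - z (Fin.last n))) := by positivity
        linarith
      have h3 : N ≤ W z := by
        have : N0 ≤ 1 / c * Real.log (1 + A * barH a ρ z) := by
          rw [← hcA]
          gcongr
          nlinarith
        have := mul_le_mul_of_nonneg_left this (by positivity : 0 ≤ N / N0)
        rwa [div_mul_cancel₀ _ hN0.ne'] at this
      linarith
  have hzH : z ∈ halfSpace n := hzn
  have hKn : K ∈ 𝓝 z := by
    refine Filter.inter_mem ?_ ?_
    · filter_upwards [(isOpen_halfSpace n).mem_nhds hzH] with w hw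
      exact le_of_lt hw
    · filter_upwards [Metric.isOpen_ball.mem_nhds (show z ∈ Metric.ball a ρ by
        simpa [dist_eq_norm] using hzρ)] with w hw
      exact Metric.ball_subset_closedBall hw
  have hloc : IsLocalMax (fun w => f w - W w) z := hzmax.isLocalMax hKn
  have hcd : ContDiffAt ℝ 2 f z := (hf2 z hzH).contDiffAt ((isOpen_halfSpace n).mem_nhds hzH)
  choose Hj hHj using fun j => jet_barH a z ρ j
  set P := A / (c * (1 + A * barH a ρ z)) with hP
  have hPpos : 0 < P := by positivity
  set L := N / N0 with hL
  have hLpos : 0 < L := by positivity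
  have key : ∀ j, fderiv ℝ f z (EuclideanSpace.single j 1) = L * (P * Hj j) ∧
      fderiv ℝ (fderiv ℝ f) z (EuclideanSpace.single j 1) (EuclideanSpace.single j 1) ≤
        L * (-c * P ^ 2 * Hj j ^ 2 + P * ((2 - 2 * (n + 2) * (if j = Fin.last n then 1 else 0)) / ρ ^ 2)) := by
    intro j
    have j1 := jet_of_contDiffAt hcd (EuclideanSpace.single j (1:ℝ))
    have e0 : z + (0:ℝ) • EuclideanSpace.single j (1:ℝ) = z := by simp
    have j2 := (jet_log_barrier (c := c) (A := A) (hHj j) hc (by rw [e0]; positivity)).const_mul L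
    simp only [e0] at j2
    have j3 := j1.sub j2
    have hcomp : IsLocalMax (fun s : ℝ => f (z + s • EuclideanSpace.single j (1:ℝ)) -
        L * (1 / c * Real.log (1 + A * barH a ρ (z + s • EuclideanSpace.single j (1:ℝ))))) 0 := by
      have hcont : Continuous fun s : ℝ => z + s • EuclideanSpace.single j (1:ℝ) := by fun_prop
      have ht : Tendsto (fun s : ℝ => z + s • EuclideanSpace.single j (1:ℝ)) (𝓝 0) (𝓝 z) := by
        have := hcont.tendsto 0
        rwa [e0] at this
      have := ht.eventually hloc
      filter_upwards [this] with s hs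
      simpa only [e0] using hs
    obtain ⟨k1, k2⟩ := j3.max hcomp
    exact ⟨by linarith, by linarith⟩
  set S := ∑ j, Hj j ^ 2 with hS
  have hS0 : 0 ≤ S := Finset.sum_nonneg fun j _ => sq_nonneg _
  have hlap : laplacian f z ≤ L * (-c * P ^ 2 * S - 2 * P / ρ ^ 2) := by
    rw [laplacian_eq]
    refine (Finset.sum_le_sum fun j _ => (key j).2).trans (le_of_eq ?_)
    rw [← Finset.mul_sum, Finset.sum_add_distrib, ← Finset.mul_sum, ← Finset.mul_sum,
      ← Finset.sum_div, Finset.sum_sub_distrib, ← Finset.mul_sum]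
    have hone : ∑ j : Fin (n + 1), (if j = Fin.last n then (1:ℝ) else 0) = 1 := by simp
    rw [hone, ← hS, Finset.sum_const, Finset.card_univ, Fintype.card_fin, nsmul_eq_mul]
    push_cast
    ring
  have hgrad : ‖gradient f z‖ = L * (P * Real.sqrt S) := by
    have h1 : ‖gradient f z‖ ^ 2 = (L * (P * Real.sqrt S)) ^ 2 := by
      rw [gradient_norm_sq, mul_pow, mul_pow, Real.sq_sqrt hS0, hS, Finset.mul_sum, Finset.mul_sum]
      refine Finset.sum_congr rfl fun j _ => ?_
      rw [(key j).1]; ring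
    exact (pow_left_inj₀ (norm_nonneg _) (by positivity) two_ne_zero).1 h1
  have hs := hsub z hzH
  rw [hgrad] at hs
  set X := ρ * Real.sqrt S with hX
  have hb := hbar (barH a ρ z) X hHz hHz' (by positivity)
  rw [← hP] at hb
  have hscale : L ^ (p - 1) * ρ ^ (2 - p) ≤ 1 := by
    have h1 : L * ρ ^ ((2 - p) / (p - 1)) ≤ 1 := by
      rw [hL, div_mul_eq_mul_div, div_le_one hN0]; exact hNρ
    have hp' : 0 < p - 1 := by linarith
    have h2 := Real.rpow_le_rpow (by positivity) h1 hp'.le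
    rw [Real.mul_rpow hLpos.le (by positivity), ← Real.rpow_mul hρ.le, Real.one_rpow,
      div_mul_cancel₀ _ hp'.ne'] at h2
    exact h2
  have hfin : (L * (P * Real.sqrt S)) ^ p ≤ L / ρ ^ 2 * (P * X) ^ p := by
    have e1 : L * (P * Real.sqrt S) = L * ρ⁻¹ * (P * X) := by
      rw [hX]; field_simp
    rw [e1, Real.mul_rpow (by positivity) (by positivity)]
    refine mul_le_mul_of_nonneg_right ?_ (by positivity)
    rw [Real.mul_rpow hLpos.le (by positivity)]
    have e2 : L ^ p = L * L ^ (p - 1) := by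
      nth_rewrite 2 [← Real.rpow_one L]
      rw [← Real.rpow_add hLpos]; congr 1; ring
    have e3 : (ρ⁻¹) ^ p = ρ ^ (2 - p) / ρ ^ 2 := by
      rw [Real.inv_rpow hρ.le, ← Real.rpow_neg hρ.le, ← Real.rpow_natCast ρ 2, ← Real.rpow_sub hρ]
      congr 1; push_cast; ring
    rw [e2, e3]
    have : L * L ^ (p - 1) * (ρ ^ (2 - p) / ρ ^ 2) = L / ρ ^ 2 * (L ^ (p - 1) * ρ ^ (2 - p)) := by ring
    rw [this]
    exact mul_le_of_le_one_right (by positivity) hscale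
  have hX2 : (P * X) ^ 2 = P ^ 2 * ρ ^ 2 * S := by
    rw [hX, mul_pow, mul_pow, Real.sq_sqrt hS0]; ring
  rw [hX2] at hb
  have hb2 := mul_lt_mul_of_pos_left hb (by positivity : 0 < L / ρ ^ 2)
  have e4 : L / ρ ^ 2 * (2 * P + c * (P ^ 2 * ρ ^ 2 * S)) = -(L * (-c * P ^ 2 * S - 2 * P / ρ ^ 2)) := by
    field_simp; ring
  linarith

lemma norm_sub_foot {n : ℕ} (z : EuclideanSpace ℝ (Fin (n + 1))) (t : ℝ) (ht : 0 ≤ t) :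
    ‖z - (z - t • EuclideanSpace.single (Fin.last n) (1:ℝ))‖ = t := by
  rw [sub_sub_cancel, norm_smul, Real.norm_of_nonneg ht]; simp

lemma foot_coord {n : ℕ} (z : EuclideanSpace ℝ (Fin (n + 1))) :
    (z - z (Fin.last n) • EuclideanSpace.single (Fin.last n) (1:ℝ)) (Fin.last n) = 0 := by
  simp

set_option maxHeartbeats 1000000 in
lemma interior_bound {n : ℕ} {p : ℝ} (hp1 : 1 < p) (hp2 : p < 2)
    (f : EuclideanSpace ℝ (Fin (n + 1)) → ℝ)
    (hf2 : ContDiffOn ℝ 2 f (halfSpace n))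
    (hfc : ContinuousOn f {y | 0 ≤ y (Fin.last n)})
    (hsub : ∀ x ∈ halfSpace n, -laplacian f x ≤ ‖gradient f x‖ ^ p)
    (hf0 : ∀ x : EuclideanSpace ℝ (Fin (n + 1)), x (Fin.last n) = 0 → f x ≤ 0)
    {C : ℝ} (hC : 0 < C)
    (hgrow : ∀ x : EuclideanSpace ℝ (Fin (n + 1)), 0 < x (Fin.last n) → x (Fin.last n) ≤ 1 →
      f x * x (Fin.last n) ^ ((2 - p) / (p - 1)) ≤ C) :
    ∃ M : ℝ, 0 < M ∧ ∀ x : EuclideanSpace ℝ (Fin (n + 1)), 0 ≤ x (Fin.last n) →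
      x (Fin.last n) ≤ 1 → f x ≤ M := by
  set β := (2 - p) / (p - 1) with hβ
  have hβ0 : 0 < β := div_pos (by linarith) (by linarith)
  have hn0 : (0:ℝ) ≤ n := Nat.cast_nonneg n
  set N0 := C * ((n:ℝ) + 2) ^ β * 2 ^ β with hN0d
  have hN0 : 0 < N0 := by positivity
  obtain ⟨c, A, hc, hA, hcA, hbar⟩ := barrier_profile (n + 1) hp1 hp2 hN0
  set h0 : ℝ := 1 - ((n:ℝ) + 1) / (n + 2) ^ 2 with hh0
  have hh1 : h0 < 1 := by
    have : 0 < ((n:ℝ) + 1) / (n + 2) ^ 2 := by positivity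
    rw [hh0]; linarith
  have hh2 : 0 ≤ h0 := by
    have : ((n:ℝ) + 1) / (n + 2) ^ 2 ≤ 1 := by
      rw [div_le_one (by positivity)]; nlinarith
    rw [hh0]; linarith
  set θ := 1 / N0 * (1 / c * Real.log (1 + A * h0)) with hθ
  have hθ1 : θ < 1 := by
    have h1 : 1 / c * Real.log (1 + A * h0) < N0 := by
      rw [← hcA]
      have : Real.log (1 + A * h0) < Real.log (1 + A) :=
        Real.log_lt_log (by positivity) (by nlinarith)
      gcongr
    rw [hθ, one_div, inv_mul_lt_iff₀ hN0]; linarith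
  obtain ⟨η, hη0, hη1, hη2⟩ : ∃ η : ℝ, 0 < η ∧ η ≤ 1 / 2 ∧ θ < (1 - η) ^ β := by
    have hcont : Continuous fun η : ℝ => (1 - η) ^ β :=
      (continuous_const.sub continuous_id).rpow_const (fun _ => Or.inr hβ0.le)
    have h1 : ∀ᶠ η in 𝓝 (0:ℝ), θ < (1 - η) ^ β := by
      apply hcont.continuousAt.eventually (lt_mem_nhds _)
      simpa using hθ1
    have h2 : ∀ᶠ η in 𝓝 (0:ℝ), η < 1 / 2 := gt_mem_nhds (by norm_num)
    have h3 : ∀ᶠ η in 𝓝[>] (0:ℝ), 0 < η := self_mem_nhdsWithin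
    obtain ⟨η, e1, e2, e3⟩ :=
      (h3.and ((h2.filter_mono nhdsWithin_le_nhds).and (h1.filter_mono nhdsWithin_le_nhds))).exists
    exact ⟨η, e1, e2.le, e3⟩
  set q := (1 - η) ^ β with hq
  have hqpos : 0 < q := Real.rpow_pos_of_pos (by linarith) _
  set P0 := C * (((n:ℝ) + 3) / η) ^ β with hP0
  have hP0pos : 0 < P0 := by positivity
  have claim : ∀ a : EuclideanSpace ℝ (Fin (n + 1)), a (Fin.last n) = 0 →
      ∀ y : EuclideanSpace ℝ (Fin (n + 1)), 0 ≤ y (Fin.last n) → ‖y - a‖ ≤ 1 →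
        f y * (1 - ‖y - a‖) ^ β ≤ P0 := by
    intro a ha y hy0 hy1
    set K : Set (EuclideanSpace ℝ (Fin (n + 1))) :=
      {y | 0 ≤ y (Fin.last n)} ∩ Metric.closedBall a 1 with hK
    have hcl : IsClosed {y : EuclideanSpace ℝ (Fin (n + 1)) | 0 ≤ y (Fin.last n)} :=
      isClosed_le continuous_const (by fun_prop)
    have hKc : IsCompact K := (isCompact_closedBall a 1).inter_left hcl
    have hmem : ∀ w : EuclideanSpace ℝ (Fin (n + 1)), 0 ≤ w (Fin.last n) → ‖w - a‖ ≤ 1 → w ∈ K :=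
      fun w h1 h2 => ⟨h1, by simpa [dist_eq_norm] using h2⟩
    have hcont : Continuous fun w : EuclideanSpace ℝ (Fin (n + 1)) => (1 - ‖w - a‖) ^ β :=
      (by fun_prop : Continuous fun w : EuclideanSpace ℝ (Fin (n + 1)) =>
        (1 - ‖w - a‖)).rpow_const (fun _ => Or.inr hβ0.le)
    obtain ⟨z, hzK, hzmax⟩ := hKc.exists_isMaxOn ⟨y, hmem y hy0 hy1⟩
      ((hfc.mono inter_subset_left).mul hcont.continuousOn)
    have hmax : ∀ w : EuclideanSpace ℝ (Fin (n + 1)), 0 ≤ w (Fin.last n) → ‖w - a‖ ≤ 1 →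
        f w * (1 - ‖w - a‖) ^ β ≤ f z * (1 - ‖z - a‖) ^ β :=
      fun w h1 h2 => hzmax (hmem w h1 h2)
    refine (hmax y hy0 hy1).trans ?_
    by_contra hcon
    push Not at hcon
    have hz1 : ‖z - a‖ ≤ 1 := by simpa [dist_eq_norm] using hzK.2
    have hz0 : 0 ≤ z (Fin.last n) := hzK.1
    set D := 1 - ‖z - a‖ with hD
    have hD0 : 0 ≤ D := by rw [hD]; linarith
    have hDβ : 0 ≤ D ^ β := by positivity
    have hKpos : 0 < f z := by
      by_contra h
      push Not at h
      have := mul_nonpos_of_nonpos_of_nonneg h hDβ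
      linarith
    have hDpos : 0 < D := by
      rcases hD0.lt_or_eq with h | h
      · exact h
      · rw [← h, Real.zero_rpow hβ0.ne', mul_zero] at hcon; linarith
    set t := z (Fin.last n) with ht
    have htpos : 0 < t := by
      rcases hz0.lt_or_eq with h | h
      · exact h
      · have := hf0 z h.symm; linarith
    have ht1 : t ≤ 1 := by
      have h2 := coord_le_norm (z - a) (Fin.last n)
      have h3 : (z - a) (Fin.last n) = t := by simp [ha, ht]
      rw [h3] at h2
      exact (le_abs_self _).trans (h2.trans hz1)
    have hg := hgrow z htpos ht1
    have htD : (n + 3) * t ≤ η * D := by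
      have h1 : (t * (((n:ℝ) + 3) / η)) ^ β < D ^ β := by
        rw [Real.mul_rpow htpos.le (by positivity)]
        have h2 : f z * (t ^ β * (((n:ℝ) + 3) / η) ^ β) ≤ P0 := by
          rw [hP0, ← mul_assoc]
          gcongr
        exact lt_of_mul_lt_mul_left (h2.trans_lt hcon) hKpos.le
      have h3 := (Real.rpow_lt_rpow_iff (by positivity) hD0 hβ0).1 h1
      rw [mul_div_assoc', div_lt_iff₀ hη0] at h3
      linarith
    set ρ := ((n:ℝ) + 2) * t with hρ
    have hρ0 : 0 < ρ := by positivity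
    set N := f z / q with hNd
    have hN : 0 < N := by positivity
    set z0 := z - t • EuclideanSpace.single (Fin.last n) (1:ℝ) with hz0d
    have hz00 : z0 (Fin.last n) = 0 := foot_coord z
    have hzz0 : ‖z - z0‖ = t := norm_sub_foot z t htpos.le
    have hNρ : N * ρ ^ β ≤ N0 := by
      rw [hρ, Real.mul_rpow (by positivity) htpos.le, hN0d, hNd, div_mul_eq_mul_div,
        div_le_iff₀ hqpos]
      have h1 : 1 ≤ 2 ^ β * q := by
        rw [hq, ← Real.mul_rpow (by norm_num) (by linarith)]
        exact Real.one_le_rpow (by linarith) hβ0.le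
      calc f z * (((n:ℝ) + 2) ^ β * t ^ β) = (f z * t ^ β) * ((n:ℝ) + 2) ^ β := by ring
        _ ≤ C * ((n:ℝ) + 2) ^ β := by gcongr
        _ ≤ C * ((n:ℝ) + 2) ^ β * (2 ^ β * q) := le_mul_of_one_le_right (by positivity) h1
        _ = _ := by ring
    have hfN : ∀ w : EuclideanSpace ℝ (Fin (n + 1)), 0 ≤ w (Fin.last n) → ‖w - z0‖ = ρ →
        f w ≤ N := by
      intro w hw0 hw1
      rcases le_or_gt (f w) 0 with h | hwpos
      · linarith
      have h1 : ‖w - a‖ ≤ ρ + t + ‖z - a‖ := by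
        have e : w - a = (w - z0) - (z - z0) + (z - a) := by abel
        rw [e]
        refine (norm_add_le _ _).trans ?_
        gcongr
        refine (norm_sub_le _ _).trans ?_
        rw [hw1, hzz0]
      have h2 : (1 - η) * D ≤ 1 - ‖w - a‖ := by
        have : ρ + t = (n + 3) * t := by rw [hρ]; ring
        have : ‖z - a‖ = 1 - D := by rw [hD]; ring
        linarith
      have h3 : 0 ≤ (1 - η) * D := mul_nonneg (by linarith) hD0
      have h4 := hmax w hw0 (by linarith)
      have h5 : ((1 - η) * D) ^ β ≤ (1 - ‖w - a‖) ^ β := Real.rpow_le_rpow h3 h2 hβ0.le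
      rw [Real.mul_rpow (by linarith) hD0] at h5
      have h6 : f w * q * D ^ β ≤ f z * D ^ β := by
        refine le_trans ?_ h4
        rw [mul_assoc]
        gcongr
      have h7 := le_of_mul_le_mul_right h6 (Real.rpow_pos_of_pos hDpos _)
      rw [hNd, le_div_iff₀ hqpos]
      exact h7
    have hmain := halfball_comparison hp1 hp2 f hf2 hfc hsub hf0 hc hA hN0 hcA hbar hN hρ0 hNρ z0
      hz00 hfN z hz0 (by rw [hzz0, hρ]; nlinarith)
    have hbarz : barH z0 ρ z = h0 := by
      unfold barH
      rw [hzz0, ← ht, hρ, hh0]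
      field_simp
      ring
    rw [hbarz] at hmain
    have h8 : N / N0 * (1 / c * Real.log (1 + A * h0)) = f z * (θ / q) := by
      rw [hNd, hθ]; ring
    rw [h8] at hmain
    have h9 : θ / q < 1 := (div_lt_one hqpos).2 hη2
    exact absurd hmain (not_le.2 (mul_lt_of_lt_one_right hKpos h9))
  refine ⟨(C + P0) / (1 / 2) ^ β, by positivity, ?_⟩
  intro x hx0 hx1
  rw [le_div_iff₀ (by positivity)]
  rcases le_or_gt (f x) 0 with h | hxpos
  · have : f x * (1 / 2 : ℝ) ^ β ≤ 0 := mul_nonpos_of_nonpos_of_nonneg h (by positivity)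
    linarith
  rcases le_or_gt (1 / 2) (x (Fin.last n)) with h | h
  · have h1 := hgrow x (by linarith) hx1
    have h2 : f x * (1 / 2 : ℝ) ^ β ≤ f x * x (Fin.last n) ^ β := by gcongr
    linarith
  · have h0' := norm_sub_foot x _ hx0
    have h1 := claim _ (foot_coord x) x hx0 (by rw [h0']; exact hx1)
    rw [h0'] at h1
    have h2 : f x * (1 / 2 : ℝ) ^ β ≤ f x * (1 - x (Fin.last n)) ^ β := by
      gcongr
      linarith
    linarith

lemma linear_bound {n : ℕ} {p : ℝ} (hp1 : 1 < p) (hp2 : p < 2)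
    (f : EuclideanSpace ℝ (Fin (n + 1)) → ℝ)
    (hf2 : ContDiffOn ℝ 2 f (halfSpace n))
    (hfc : ContinuousOn f {y | 0 ≤ y (Fin.last n)})
    (hsub : ∀ x ∈ halfSpace n, -laplacian f x ≤ ‖gradient f x‖ ^ p)
    (hf0 : ∀ x : EuclideanSpace ℝ (Fin (n + 1)), x (Fin.last n) = 0 → f x ≤ 0)
    {C : ℝ} (hC : 0 < C)
    (hgrow : ∀ x : EuclideanSpace ℝ (Fin (n + 1)), 0 < x (Fin.last n) → x (Fin.last n) ≤ 1 →
      f x * x (Fin.last n) ^ ((2 - p) / (p - 1)) ≤ C) :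
    ∃ M : ℝ, 0 < M ∧ ∀ x : EuclideanSpace ℝ (Fin (n + 1)), 0 ≤ x (Fin.last n) →
      x (Fin.last n) ≤ 1 → f x ≤ M * x (Fin.last n) := by
  obtain ⟨M, hM, hMb⟩ := interior_bound hp1 hp2 f hf2 hfc hsub hf0 hC hgrow
  obtain ⟨c, A, hc, hA, hcA, hbar⟩ := barrier_profile (n + 1) hp1 hp2 hM
  have hn0 : (0:ℝ) ≤ n := Nat.cast_nonneg n
  refine ⟨A / c * (n + 3), by positivity, ?_⟩
  intro x hx0 hx1
  set t := x (Fin.last n) with ht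
  set a := x - t • EuclideanSpace.single (Fin.last n) (1:ℝ) with had
  have ha : a (Fin.last n) = 0 := foot_coord x
  have hxa : ‖x - a‖ = t := norm_sub_foot x t hx0
  have hmain := halfball_comparison (ρ := 1) (N := M) hp1 hp2 f hf2 hfc hsub hf0 hc hA hM hcA hbar
    hM one_pos (by simp) a ha (fun y h1 h2 => hMb y h1 (by
      have h3 := coord_le_norm (y - a) (Fin.last n)
      have h4 : (y - a) (Fin.last n) = y (Fin.last n) := by simp [ha]
      rw [h4, h2] at h3
      exact (le_abs_self _).trans h3)) x hx0 (by rw [hxa]; exact hx1)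
  have hb : barH a 1 x ≤ (n + 3) * t := by
    unfold barH
    rw [hxa, ← ht]
    have : (0:ℝ) ≤ n + 2 := by linarith
    have h5 : t * t ≤ t := by nlinarith
    have h6 : 0 ≤ ((n:ℝ) + 2) * (t * t) := by positivity
    ring_nf at h5 h6 ⊢
    linarith
  have hb0 : 0 ≤ barH a 1 x := by
    unfold barH
    rw [hxa, ← ht]
    have : 0 ≤ 1 - t := by linarith
    positivity
  rw [div_self hM.ne', one_mul] at hmain
  have hl : Real.log (1 + A * barH a 1 x) ≤ A * barH a 1 x := by
    have := Real.log_le_sub_one_of_pos (by positivity : 0 < 1 + A * barH a 1 x)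
    linarith
  calc f x ≤ 1 / c * Real.log (1 + A * barH a 1 x) := hmain
    _ ≤ 1 / c * (A * ((n + 3) * t)) := by
      gcongr
      exact hl.trans (by gcongr)
    _ = _ := by ring

lemma halfSpace_closure {n : ℕ} :
    {y : EuclideanSpace ℝ (Fin (n + 1)) | 0 ≤ y (Fin.last n)} ⊆ closure (halfSpace n) := by
  intro y hy
  have hcont : Continuous fun s : ℝ => y + s • EuclideanSpace.single (Fin.last n) (1:ℝ) := by
    fun_prop
  have ht : Tendsto (fun s : ℝ => y + s • EuclideanSpace.single (Fin.last n) (1:ℝ))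
      (𝓝[>] 0) (𝓝 y) := by
    have := (hcont.tendsto 0).mono_left (nhdsWithin_le_nhds (s := Ioi 0))
    simpa using this
  refine mem_closure_of_tendsto ht ?_
  filter_upwards [self_mem_nhdsWithin] with s hs
  have hy' : 0 ≤ y (Fin.last n) := hy
  have hs' : 0 < s := hs
  have : (y + s • EuclideanSpace.single (Fin.last n) (1:ℝ)) (Fin.last n) = y (Fin.last n) + s := by
    simp
  show 0 < (y + s • EuclideanSpace.single (Fin.last n) (1:ℝ)) (Fin.last n)
  rw [this]; linarith

lemma laplacian_neg {d : ℕ} (u : EuclideanSpace ℝ (Fin d) → ℝ) (x : EuclideanSpace ℝ (Fin d)) :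
    laplacian (-u) x = -laplacian u x := by
  unfold laplacian
  rw [iteratedFDeriv_neg]
  simp

lemma norm_gradient_neg {d : ℕ} (u : EuclideanSpace ℝ (Fin d) → ℝ)
    (x : EuclideanSpace ℝ (Fin d)) : ‖gradient (-u) x‖ = ‖gradient u x‖ := by
  unfold gradient
  rw [fderiv_neg, map_neg, norm_neg]

/-- Uniform Lipschitz control near the boundary: for `1 < p < 2`, any classical
solution of `-Δu = |∇u|^p` in the half-space with zero boundary data satisfies
`|u(x', xₙ)| ≤ M₁ xₙ` for all `x'` and all `0 < xₙ ≤ 1`. -/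
theorem uniform_lipschitz_near_boundary (n : ℕ) (p : ℝ) (hp1 : 1 < p) (hp2 : p < 2)
    (u : EuclideanSpace ℝ (Fin (n + 1)) → ℝ)
    (hu2 : ContDiffOn ℝ 2 u (halfSpace n))
    (huc : ContinuousOn u (closure (halfSpace n)))
    (heq : ∀ x ∈ halfSpace n, -laplacian u x = ‖gradient u x‖ ^ p)
    (hbc : ∀ x : EuclideanSpace ℝ (Fin (n + 1)), x (Fin.last n) = 0 → u x = 0) :
    ∃ M₁ : ℝ, 0 < M₁ ∧
      ∀ x : EuclideanSpace ℝ (Fin (n + 1)),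
        0 < x (Fin.last n) → x (Fin.last n) ≤ 1 → |u x| ≤ M₁ * x (Fin.last n) := by
  obtain ⟨C, hC, hgrow⟩ := growth_bound hp1 hp2 u hu2 heq
  have hg : ∀ x : EuclideanSpace ℝ (Fin (n + 1)), 0 < x (Fin.last n) → x (Fin.last n) ≤ 1 →
      |u x| * x (Fin.last n) ^ ((2 - p) / (p - 1)) ≤ C := by
    intro x h0 h1
    have h2 := hgrow x h0 h1
    have h3 := Real.rpow_pos_of_pos h0 ((2 - p) / (p - 1))
    rw [Real.rpow_neg h0.le, ← div_eq_mul_inv, le_div_iff₀ h3] at h2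
    exact h2
  have huc' := huc.mono (halfSpace_closure (n := n))
  obtain ⟨M, hM, hMb⟩ := linear_bound hp1 hp2 u hu2 huc' (fun x hx => (heq x hx).le)
    (fun x hx => (hbc x hx).le) hC (fun x h0 h1 => by
      refine le_trans ?_ (hg x h0 h1)
      gcongr
      exact le_abs_self _)
  obtain ⟨M', hM', hMb'⟩ := linear_bound hp1 hp2 (-u) hu2.neg huc'.neg (fun x hx => by
      rw [laplacian_neg, norm_gradient_neg, heq x hx]
      have : 0 ≤ ‖gradient u x‖ ^ p := by positivity
      linarith)
    (fun x hx => by simp [hbc x hx]) hC (fun x h0 h1 => by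
      refine le_trans ?_ (hg x h0 h1)
      gcongr
      exact neg_le_abs _)
  refine ⟨M + M', by positivity, ?_⟩
  intro x h0 h1
  have a1 := hMb x h0.le h1
  have a2 := hMb' x h0.le h1
  have a3 : -u x ≤ M' * x (Fin.last n) := a2
  rw [abs_le]
  constructor <;> nlinarith [mul_pos hM h0, mul_pos hM' h0]
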